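/- arXiv:2007.09962 — 2 statements merged into one kernel-verified Lean document; each statement's English description precedes it below -/
import Mathlib

section
/- Fix n ∈ ℕ. Let T be a form of degree d = 8+2n in 3 variables and let A = {P_1,…,P_r} ⊂ ℙ^2 be a non-redundant decomposition of T of length r = ℓ(A) ≤ 11+3n. Then either A is the unique decomposition of T of length at most r (so that T has rank r and is identifiable), or T admits infinitely many pairwise distinct decompositions of length at most 11+3n. -/
open MvPolynomial
open scoped Classical

noncomputable section

/-- Points of the projective space `ℙ^m` over `ℂ`. -/
abbrev Pt (m : ℕ) := Projectivization ℂ (Fin (m + 1) → ℂ)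

/-- The linear form with coefficient vector `v`. -/
def linForm {m : ℕ} (v : Fin (m + 1) → ℂ) : MvPolynomial (Fin (m + 1)) ℂ :=
  ∑ i, C (v i) * X i

/-- The degree-`d` Veronese image of a projective point, i.e. the `d`-th power `L^d`
of a linear form `L` representing the point. -/
def powRep {m : ℕ} (d : ℕ) (P : Pt m) : MvPolynomial (Fin (m + 1)) ℂ :=
  linForm P.rep ^ d

/-- `A ⊆ ℙ^m` is a decomposition of the form `T` of degree `d`:
`T = a_1 L_1^d + ⋯ + a_r L_r^d`. -/
def IsDecomp {m : ℕ} (d : ℕ) (A : Finset (Pt m))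
    (T : MvPolynomial (Fin (m + 1)) ℂ) : Prop :=
  ∃ a : Pt m → ℂ, T = ∑ P ∈ A, a P • powRep d P

/-- A decomposition is non-redundant if `T` is not in the span of `ν_d(A')`
for any proper subset `A' ⊊ A`. -/
def NonRedundant {m : ℕ} (d : ℕ) (A : Finset (Pt m))
    (T : MvPolynomial (Fin (m + 1)) ℂ) : Prop :=
  ∀ A' : Finset (Pt m), A' ⊂ A →
    T ∉ Submodule.span ℂ (powRep d '' (A' : Set (Pt m)))

/-- The Cayley–Bacharach property `CB(d)`. -/
def CB {m : ℕ} (d : ℕ) (Z : Finset (Pt m)) : Prop :=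
  ∀ P ∈ Z, ∀ F : MvPolynomial (Fin (m + 1)) ℂ, F.IsHomogeneous d →
    (∀ Q ∈ Z.erase P, eval Q.rep F = 0) → eval P.rep F = 0

/-- The `d`-th Kruskal rank of a finite set `Z ⊂ ℙ^m`: the largest `k` (at most `ℓ(Z)`)
such that the Veronese images of every subset of `Z` of cardinality at most `k`
are linearly independent. -/
def kruskalRank {m : ℕ} (d : ℕ) (Z : Finset (Pt m)) : ℕ :=
  sSup {k | k ≤ Z.card ∧ ∀ S ⊆ Z, S.card ≤ k →
    LinearIndependent ℂ (fun P : S => powRep d P.1)}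

/-- The evaluation map of degree `d` on (representatives of) the points of `Z`. -/
def evalMap {m : ℕ} (Z : Finset (Pt m)) (d : ℕ) :
    homogeneousSubmodule (Fin (m + 1)) ℂ d →ₗ[ℂ] (Z → ℂ) where
  toFun F P := eval (P : Pt m).rep F.1
  map_add' F G := by funext P; simp
  map_smul' c F := by funext P; simp [smul_eq_C_mul]

/-- The Hilbert function of a finite set of points `Z ⊂ ℙ^m`. -/
def hf {m : ℕ} (Z : Finset (Pt m)) (d : ℕ) : ℕ :=
  Module.finrank ℂ (LinearMap.range (evalMap Z d))

/-- The first difference of the Hilbert function (with `h_Z(j) = 0` for `j < 0`). -/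
def Dhf {m : ℕ} (Z : Finset (Pt m)) (j : ℕ) : ℤ :=
  if j = 0 then (hf Z 0 : ℤ) else (hf Z j : ℤ) - (hf Z (j - 1) : ℤ)


lemma poly_family (Θ : Finset ℂ) (hΘ : Θ.Nonempty) (a : ℂ → ℂ) (ha : ∀ t ∈ Θ, a t ≠ 0) :
    {R : Finset ℂ | R.card = Θ.card ∧ ∃ b : ℂ → ℂ, ∀ p : Polynomial ℂ,
      p.natDegree + 2 ≤ 2 * Θ.card →
      ∑ t ∈ Θ, a t * p.eval t = ∑ s ∈ R, b s * p.eval s}.Infinite := by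
  have hinj : Set.InjOn (id : ℂ → ℂ) Θ := Function.injective_id.injOn
  set f : Polynomial ℂ := Lagrange.nodal Θ id with hf
  set w : ℂ → ℂ := fun t => ∏ u ∈ Θ.erase t, (t - u) with hw
  have hw0 : ∀ t, w t ≠ 0 := by
    intro t
    refine Finset.prod_ne_zero_iff.2 fun u hu => ?_
    exact sub_ne_zero.2 (Finset.ne_of_mem_erase hu).symm
  set g0 : Polynomial ℂ := Lagrange.interpolate Θ id (fun t => (a t * w t)⁻¹) with hg0
  have hg0e : ∀ t ∈ Θ, g0.eval t = (a t * w t)⁻¹ := fun t ht =>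
    Lagrange.eval_interpolate_at_node (v := id) _ hinj ht
  have hg0ne : ∀ t ∈ Θ, g0.eval t ≠ 0 := fun t ht => by
    rw [hg0e t ht]; exact inv_ne_zero (mul_ne_zero (ha t ht) (hw0 t))
  have hfe : ∀ t ∈ Θ, f.eval t = 0 := fun t ht => Lagrange.eval_nodal_at_node (v := id) ht
  have hfz : ∀ t, f.eval t = 0 → t ∈ Θ := by
    intro t ht
    rw [hf, Lagrange.eval_nodal, Finset.prod_eq_zero_iff] at ht
    obtain ⟨u, hu, h⟩ := ht
    rw [sub_eq_zero] at h; simpa [h] using hu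
  have hdeg : ∀ ε : ℂ, (Polynomial.C ε * g0).degree < f.degree := by
    intro ε
    rw [hf, Lagrange.degree_nodal]
    refine lt_of_le_of_lt ?_ (Lagrange.degree_interpolate_lt (fun t => (a t * w t)⁻¹) hinj)
    by_cases h : ε = 0
    · simp [h]
    · rw [Polynomial.degree_C_mul h]
  set G : ℂ → Polynomial ℂ := fun ε => f + Polynomial.C ε * g0 with hG
  have hGm : ∀ ε, (G ε).Monic := fun ε =>
    (Lagrange.nodal_monic).add_of_left (hdeg ε)
  have hGd : ∀ ε, (G ε).natDegree = Θ.card := by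
    intro ε
    rw [hG]; simp only
    rw [Polynomial.natDegree_add_eq_left_of_degree_lt (hdeg ε)]
    exact Lagrange.natDegree_nodal
  have hGe : ∀ ε x, (G ε).eval x = f.eval x + ε * g0.eval x := by
    intro ε x; simp [hG]
  set W : Polynomial ℂ := g0 * f.derivative - g0.derivative * f with hW
  have hfd : ∀ t ∈ Θ, f.derivative.eval t = w t := by
    intro t ht
    have := Lagrange.eval_nodal_derivative_eval_node_eq (s := Θ) (v := (id : ℂ → ℂ)) ht
    simp only [id] at this
    rw [hf]; simp only [hw]
    erw [this, Lagrange.eval_nodal]; rfl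
  have hW0 : W ≠ 0 := by
    obtain ⟨t, ht⟩ := hΘ
    intro h
    have : W.eval t = 0 := by rw [h]; simp
    rw [hW] at this
    simp only [Polynomial.eval_sub, Polynomial.eval_mul, hfe t ht, hfd t ht, mul_zero, sub_zero] at this
    exact mul_ne_zero (hg0ne t ht) (hw0 t) this
  set bad : Finset ℂ := insert 0 (W.roots.toFinset.image fun s => - f.eval s / g0.eval s) with hbad
  have hI : ((bad : Set ℂ)ᶜ).Infinite := bad.finite_toSet.infinite_compl
  have hgood : ∀ ε, ε ∉ bad → (G ε).roots.Nodup := by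
    intro ε hε
    apply Polynomial.nodup_roots
    rw [Polynomial.separable_def,
      Polynomial.isCoprime_iff_aeval_ne_zero_of_isAlgClosed (k := ℂ) ℂ]
    by_contra! hcop
    obtain ⟨x, h1, h2⟩ := hcop
    rw [Polynomial.coe_aeval_eq_eval] at h1 h2
    rw [hGe] at h1
    have h2' : f.derivative.eval x + ε * g0.derivative.eval x = 0 := by
      simpa [hG] using h2
    have hε0 : ε ≠ 0 := fun h => hε (by simp [hbad, h])
    have hgx : g0.eval x ≠ 0 := by
      intro h0
      rw [h0, mul_zero, add_zero] at h1
      exact hg0ne x (hfz x h1) h0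
    apply hε
    rw [hbad, Finset.mem_insert]; right
    rw [Finset.mem_image]
    refine ⟨x, ?_, ?_⟩
    · rw [Multiset.mem_toFinset, Polynomial.mem_roots hW0, Polynomial.IsRoot.def, hW]
      simp only [Polynomial.eval_sub, Polynomial.eval_mul]
      linear_combination g0.eval x * h2' - g0.derivative.eval x * h1
    · field_simp
      linear_combination -h1
  set R : ℂ → Finset ℂ := fun ε => (G ε).roots.toFinset with hR
  have hRm : ∀ ε x, x ∈ R ε ↔ (G ε).eval x = 0 := by
    intro ε x
    rw [hR, Multiset.mem_toFinset, Polynomial.mem_roots (hGm ε).ne_zero, Polynomial.IsRoot.def]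
  have hRcard : ∀ ε, ε ∉ bad → (R ε).card = Θ.card := by
    intro ε hε
    rw [hR]; simp only
    rw [Multiset.toFinset_card_of_nodup (hgood ε hε), IsAlgClosed.card_roots_eq_natDegree, hGd]
  refine Set.infinite_of_injOn_mapsTo (s := ((bad : Set ℂ)ᶜ)) (f := R) ?_ ?_ hI
  · intro ε hε ε' hε' h
    have hne : (R ε).Nonempty := by
      rw [← Finset.card_pos, hRcard ε hε]; exact Finset.card_pos.2 hΘ
    obtain ⟨x, hx⟩ := hne
    have hx' : x ∈ R ε' := h ▸ hx
    rw [hRm, hGe] at hx hx'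
    have hgx : g0.eval x ≠ 0 := by
      intro h0
      rw [h0, mul_zero, add_zero] at hx
      exact hg0ne x (hfz x hx) h0
    have : (ε - ε') * g0.eval x = 0 := by linear_combination hx - hx'
    rcases mul_eq_zero.1 this with h | h
    · exact sub_eq_zero.1 h
    · exact absurd h hgx
  · intro ε hε
    have hε0 : ε ≠ 0 := fun h => hε (by simp [hbad, h])
    refine ⟨hRcard ε hε, fun s => - ε * (∏ u ∈ (Θ ∪ R ε).erase s, (s - u))⁻¹, ?_⟩
    intro p hp
    have hdisj : Disjoint Θ (R ε) := by
      rw [Finset.disjoint_left]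
      intro t ht ht'
      rw [hRm, hGe, hfe t ht, zero_add] at ht'
      exact mul_ne_zero hε0 (hg0ne t ht) ht'
    have hcard : (Θ ∪ R ε).card = 2 * Θ.card := by
      rw [Finset.card_union_of_disjoint hdisj, hRcard ε hε, two_mul]
    have hpos : 0 < Θ.card := Finset.card_pos.2 hΘ
    have key := Lagrange.coeff_eq_sum (s := Θ ∪ R ε) (v := (id : ℂ → ℂ))
      Function.injective_id.injOn (P := p) (by
        rw [hcard]
        refine lt_of_le_of_lt Polynomial.degree_le_natDegree ?_
        exact_mod_cast (by omega))
    rw [Polynomial.coeff_eq_zero_of_natDegree_lt (by rw [hcard]; omega),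
      Finset.sum_union hdisj] at key
    have h1 : ∀ t ∈ Θ, ∏ u ∈ (Θ ∪ R ε).erase t, (t - u) = ε * (a t)⁻¹ := by
      intro t ht
      have ht' : t ∉ R ε := Finset.disjoint_left.1 hdisj ht
      rw [Finset.erase_union_distrib, Finset.erase_eq_of_notMem ht', Finset.prod_union]
      · have h2 : ∏ u ∈ R ε, (t - u) = (G ε).eval t := by
          have hs := (IsAlgClosed.splits (G ε)).eq_prod_roots_of_monic (hGm ε)
          rw [hs, Polynomial.eval_multiset_prod, Multiset.map_map]
          rw [Finset.prod_eq_multiset_prod, hR]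
          simp only [Multiset.toFinset_val]
          rw [Multiset.dedup_eq_self.2 (hgood ε hε)]
          simp
        rw [h2, hGe, hfe t ht, hg0e t ht]
        have := hw0 t
        change w t * _ = _
        have := ha t ht
        field_simp
        ring
      · exact Finset.disjoint_of_subset_left (Finset.erase_subset _ _) hdisj
    have h3 : ∑ t ∈ Θ, Polynomial.eval (id t) p / ∏ j ∈ (Θ ∪ R ε).erase t, (id t - id j)
        = ε⁻¹ * ∑ t ∈ Θ, a t * p.eval t := by
      rw [Finset.mul_sum]
      refine Finset.sum_congr rfl fun t ht => ?_
      simp only [id]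
      rw [h1 t ht]
      have := ha t ht
      field_simp
    rw [h3] at key
    have : ∑ s ∈ R ε, -ε * (∏ u ∈ (Θ ∪ R ε).erase s, (s - u))⁻¹ * p.eval s
      = -ε * ∑ t ∈ R ε, Polynomial.eval (id t) p / ∏ j ∈ (Θ ∪ R ε).erase t, (id t - id j) := by
      rw [Finset.mul_sum]
      refine Finset.sum_congr rfl fun t ht => ?_
      simp only [id]
      ring
    rw [this]
    have h4 : ε * (ε⁻¹ * ∑ t ∈ Θ, a t * p.eval t) = ∑ t ∈ Θ, a t * p.eval t := by
      field_simp
    linear_combination -h4 - ε * key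

lemma isDecomp_iff {d : ℕ} {B : Finset (Pt 2)} {T : MvPolynomial (Fin 3) ℂ} :
    IsDecomp d B T ↔ T ∈ Submodule.span ℂ (powRep d '' (B : Set (Pt 2))) := by
  rw [Submodule.mem_span_image_finset_iff_exists_fun']
  constructor
  · rintro ⟨a, h⟩; exact ⟨a, h.symm⟩
  · rintro ⟨a, h⟩; exact ⟨a, h.symm⟩

lemma IsDecomp.mono {d : ℕ} {B B' : Finset (Pt 2)} {T : MvPolynomial (Fin 3) ℂ}
    (h : IsDecomp d B T) (hB : B ⊆ B') : IsDecomp d B' T := by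
  rw [isDecomp_iff] at *
  exact Submodule.span_mono (Set.image_mono (by exact_mod_cast hB)) h

lemma IsDecomp.add {d : ℕ} {B B' : Finset (Pt 2)} {T T' : MvPolynomial (Fin 3) ℂ}
    (h : IsDecomp d B T) (h' : IsDecomp d B' T') : IsDecomp d (B ∪ B') (T + T') := by
  have h1 := h.mono (Finset.subset_union_left (s₂ := B'))
  have h2 := h'.mono (Finset.subset_union_right (s₁ := B))
  rw [isDecomp_iff] at *
  exact add_mem h1 h2

lemma extend_inf {d : ℕ} {A A0 : Finset (Pt 2)} {T : MvPolynomial (Fin 3) ℂ} (a : Pt 2 → ℂ)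
    (hT : T = ∑ P ∈ A, a P • powRep d P) (hs : A0 ⊆ A)
    (hinf : {B : Finset (Pt 2) | B.card ≤ A0.card ∧
      IsDecomp d B (∑ P ∈ A0, a P • powRep d P)}.Infinite) :
    {B : Finset (Pt 2) | IsDecomp d B T ∧ B.card ≤ A.card}.Infinite := by
  intro hfin
  apply hinf
  refine (hfin.biUnion (t := fun B => (B.powerset : Set (Finset (Pt 2))))
    (fun B _ => B.powerset.finite_toSet)).subset ?_
  rintro B ⟨hB1, hB2⟩
  rw [Set.mem_iUnion₂]
  refine ⟨B ∪ (A \ A0), ⟨?_, ?_⟩, by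
    rw [Finset.mem_coe, Finset.mem_powerset]; exact Finset.subset_union_left⟩
  · rw [hT, ← Finset.sum_sdiff hs, add_comm]
    exact hB2.add ⟨a, rfl⟩
  · refine (Finset.card_union_le _ _).trans ?_
    rw [Finset.card_sdiff_of_subset hs]
    have := Finset.card_le_card hs
    omega

lemma eval_linForm (v x : Fin 3 → ℂ) : eval x (linForm (m := 2) v) = ∑ i, v i * x i := by
  simp [linForm]

lemma linForm_smul (c : ℂ) (v : Fin 3 → ℂ) :
    linForm (m := 2) (c • v) = c • linForm (m := 2) v := by
  simp [linForm, Finset.smul_sum, smul_eq_C_mul, mul_assoc]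

lemma curve_family (d w : ℕ) (φ : Fin 3 → Polynomial ℂ) (hφ : ∀ i, (φ i).natDegree ≤ w)
    (hne : ∀ t : ℂ, (fun i => (φ i).eval t) ≠ 0)
    (hinj : Function.Injective fun t : ℂ =>
      (Projectivization.mk ℂ (fun i => (φ i).eval t) (hne t) : Pt 2))
    (A0 : Finset (Pt 2))
    (hA0 : ∀ P ∈ A0, ∃ t : ℂ, P = Projectivization.mk ℂ (fun i => (φ i).eval t) (hne t))
    (hcard : w * d + 2 = 2 * A0.card) (a : Pt 2 → ℂ) (ha : ∀ P ∈ A0, a P ≠ 0) :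
    {B : Finset (Pt 2) | B.card ≤ A0.card ∧
      IsDecomp d B (∑ P ∈ A0, a P • powRep d P)}.Infinite := by
  set vec : ℂ → Fin 3 → ℂ := fun t i => (φ i).eval t with hvec
  set pt : ℂ → Pt 2 := fun t => Projectivization.mk ℂ (vec t) (hne t) with hpt
  have hc : ∀ t, ∃ c : ℂ, c ≠ 0 ∧ (pt t).rep = c • vec t := by
    intro t
    obtain ⟨u, hu⟩ := Projectivization.exists_smul_eq_mk_rep ℂ (vec t) (hne t)
    exact ⟨u, u.ne_zero, by rw [← Units.smul_def]; exact hu.symm⟩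
  choose c hc0 hcr using hc
  have hpow : ∀ t, powRep d (pt t) = (c t) ^ d • linForm (m := 2) (vec t) ^ d := by
    intro t
    rw [powRep, hcr, linForm_smul, smul_pow]
  have hΘ : ∃ Θ : Finset ℂ, Θ.image pt = A0 := by
    choose! τ hτ using hA0
    refine ⟨A0.image τ, ?_⟩
    rw [Finset.image_image]
    conv_rhs => rw [← Finset.image_id (s := A0)]
    exact Finset.image_congr fun P hP => (hτ P hP).symm
  obtain ⟨Θ, rfl⟩ := hΘ
  have hcd : ∀ S : Finset ℂ, (S.image pt).card = S.card := fun S =>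
    Finset.card_image_of_injective S hinj
  have hsum : ∀ (S : Finset ℂ) (b : Pt 2 → ℂ), ∑ P ∈ S.image pt, b P • powRep d P =
      ∑ t ∈ S, (b (pt t) * c t ^ d) • linForm (m := 2) (vec t) ^ d := by
    intro S b
    rw [Finset.sum_image hinj.injOn]
    refine Finset.sum_congr rfl fun t _ => ?_
    rw [hpow, smul_smul]
  rw [hcd] at hcard ⊢
  have hne' : Θ.Nonempty := by rw [← Finset.card_pos]; omega
  have key := poly_family Θ hne' (fun t => a (pt t) * c t ^ d) (fun t ht =>
    mul_ne_zero (ha _ (Finset.mem_image_of_mem _ ht)) (pow_ne_zero _ (hc0 t)))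
  refine Set.infinite_of_injOn_mapsTo (f := fun R : Finset ℂ => R.image pt)
    (Finset.image_injective hinj).injOn ?_ key
  rintro R ⟨hR1, b, hb⟩
  refine ⟨by rw [hcd, hR1], Function.extend pt (fun s => b s * ((c s) ^ d)⁻¹) 0, ?_⟩
  rw [hsum, hsum]
  apply MvPolynomial.funext
  intro x
  set p : Polynomial ℂ := (∑ i, φ i * Polynomial.C (x i)) ^ d with hp
  have hpe : ∀ t, eval x (linForm (m := 2) (vec t) ^ d) = p.eval t := by
    intro t
    rw [map_pow, eval_linForm, hp, Polynomial.eval_pow, Polynomial.eval_finsetSum]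
    simp [hvec]
  have hpd : p.natDegree ≤ w * d := by
    rw [hp, mul_comm]
    refine Polynomial.natDegree_pow_le_of_le d ?_
    refine Polynomial.natDegree_sum_le_of_forall_le _ _ fun i _ => ?_
    exact (Polynomial.natDegree_mul_C_le _ _).trans (hφ i)
  have := hb p (by omega)
  simp only [map_sum, smul_eval, hpe]
  rw [this]
  refine Finset.sum_congr rfl fun s _ => ?_
  rw [hinj.extend_apply]
  have := pow_ne_zero d (hc0 s)
  field_simp

/-- A fully supported linear relation in degree `d`. -/
def IsRel (d : ℕ) (Z : Finset (Pt 2)) : Prop :=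
  ∃ l : Pt 2 → ℂ, (∀ P ∈ Z, l P ≠ 0) ∧
    ∀ F : MvPolynomial (Fin 3) ℂ, F.IsHomogeneous d → ∑ P ∈ Z, l P * eval P.rep F = 0

/-- Points of `Z` on `F`. -/
def On (Z : Finset (Pt 2)) (F : MvPolynomial (Fin 3) ℂ) : Finset (Pt 2) :=
  Z.filter fun P => eval P.rep F = 0

/-- Points of `Z` off `F`. -/
def Off (Z : Finset (Pt 2)) (F : MvPolynomial (Fin 3) ℂ) : Finset (Pt 2) :=
  Z.filter fun P => eval P.rep F ≠ 0

/-- No three collinear. -/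
def LGP (Z : Finset (Pt 2)) : Prop :=
  ∀ F : MvPolynomial (Fin 3) ℂ, F.IsHomogeneous 1 → F ≠ 0 → (On Z F).card ≤ 2

lemma on_add_off (Z : Finset (Pt 2)) (F : MvPolynomial (Fin 3) ℂ) :
    (On Z F).card + (Off Z F).card = Z.card :=
  Finset.card_filter_add_card_filter_not _

lemma mem_on {Z : Finset (Pt 2)} {F : MvPolynomial (Fin 3) ℂ} {P : Pt 2} :
    P ∈ On Z F ↔ P ∈ Z ∧ eval P.rep F = 0 := Finset.mem_filter

lemma mem_off {Z : Finset (Pt 2)} {F : MvPolynomial (Fin 3) ℂ} {P : Pt 2} :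
    P ∈ Off Z F ↔ P ∈ Z ∧ eval P.rep F ≠ 0 := Finset.mem_filter

lemma LGP.mono {Z Z' : Finset (Pt 2)} (h : LGP Z) (hs : Z' ⊆ Z) : LGP Z' := fun F h1 h2 =>
  (Finset.card_le_card (Finset.filter_subset_filter _ hs)).trans (h F h1 h2)

lemma IsRel.resid {d m : ℕ} {Z : Finset (Pt 2)} (h : IsRel (d + m) Z)
    {G : MvPolynomial (Fin 3) ℂ} (hG : G.IsHomogeneous m) : IsRel d (Off Z G) := by
  obtain ⟨l, hl, hr⟩ := h
  refine ⟨fun P => l P * eval P.rep G, fun P hP => ?_, fun F hF => ?_⟩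
  · rw [mem_off] at hP
    exact mul_ne_zero (hl P hP.1) hP.2
  · have := hr (F * G) (hF.mul hG)
    rw [Off, Finset.sum_filter]
    refine Eq.trans ?_ this
    refine Finset.sum_congr rfl fun P _ => ?_
    split_ifs with h
    · rw [map_mul]; ring
    · push Not at h; simp [h]

lemma linForm_hom (v : Fin 3 → ℂ) : (linForm (m := 2) v).IsHomogeneous 1 :=
  IsHomogeneous.sum _ _ _ fun _ _ => isHomogeneous_C_mul_X _ _

lemma linForm_ne_zero {v : Fin 3 → ℂ} (hv : v ≠ 0) : linForm (m := 2) v ≠ 0 := by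
  intro h
  apply hv
  funext i
  have := eval_linForm v (Pi.single i 1)
  rw [h, map_zero] at this
  simpa [Pi.single_apply] using this.symm

lemma exists_eval_ne {F : MvPolynomial (Fin 3) ℂ} (hF : F ≠ 0) : ∃ x, eval x F ≠ 0 := by
  by_contra! h
  exact hF (MvPolynomial.funext fun x => by rw [h x, map_zero])

lemma exists_generic (Z : Finset (Pt 2)) :
    ∃ G : MvPolynomial (Fin 3) ℂ, G.IsHomogeneous 1 ∧ ∀ P ∈ Z, eval P.rep G ≠ 0 := by
  have h : ∏ P ∈ Z, linForm (m := 2) P.rep ≠ 0 :=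
    Finset.prod_ne_zero_iff.2 fun P _ => linForm_ne_zero P.rep_nonzero
  obtain ⟨x, hx⟩ := exists_eval_ne h
  rw [map_prod, Finset.prod_ne_zero_iff] at hx
  refine ⟨linForm (m := 2) x, linForm_hom x, fun P hP => ?_⟩
  have := hx P hP
  rw [eval_linForm] at this ⊢
  simpa only [mul_comm] using this

lemma IsRel.pred {d : ℕ} {Z : Finset (Pt 2)} (h : IsRel (d + 1) Z) : IsRel d Z := by
  obtain ⟨G, hG, hn⟩ := exists_generic Z
  have := h.resid hG
  rwa [Off, Finset.filter_true_of_mem hn] at this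

lemma exists_sep {P Q : Pt 2} (h : P ≠ Q) :
    ∃ G : MvPolynomial (Fin 3) ℂ, G.IsHomogeneous 1 ∧ eval P.rep G ≠ 0 ∧ eval Q.rep G = 0 := by
  by_contra! hcon
  have key : ∀ c : Fin 3 → ℂ, ∑ i, c i * Q.rep i = 0 → ∑ i, c i * P.rep i = 0 := by
    intro c hc
    by_contra h2
    exact hcon (linForm (m := 2) c) (linForm_hom c) (by rwa [eval_linForm]) (by rwa [eval_linForm])
  obtain ⟨i, hi⟩ : ∃ i, Q.rep i ≠ 0 := by
    by_contra! h0
    exact Q.rep_nonzero (funext h0)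
  apply h
  rw [← P.mk_rep, ← Q.mk_rep, Projectivization.mk_eq_mk_iff']
  refine ⟨P.rep i / Q.rep i, funext fun j => ?_⟩
  have := key (fun k => (if k = i then - Q.rep j else 0) + (if k = j then Q.rep i else 0)) (by
    simp only [add_mul, Finset.sum_add_distrib, ite_mul, zero_mul, Finset.sum_ite_eq',
      Finset.mem_univ, if_true]
    ring)
  simp only [add_mul, Finset.sum_add_distrib, ite_mul, zero_mul, Finset.sum_ite_eq',
      Finset.mem_univ, if_true] at this
  simp only [Pi.smul_apply, smul_eq_mul]
  field_simp
  linear_combination -this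

instance finite_S (e : ℕ) : Module.Finite ℂ (homogeneousSubmodule (Fin 3) ℂ e) :=
  Module.Finite.iff_fg.2 (homogeneousSubmodule_fg _ _ e)

instance finite_S2 (e : ℕ) : Module.Finite ℂ (homogeneousSubmodule (Fin (2 + 1)) ℂ e) :=
  finite_S e

lemma finrank_S (e : ℕ) :
    Module.finrank ℂ (homogeneousSubmodule (Fin 3) ℂ e) = (e + 2).choose 2 := by
  rw [homogeneousSubmodule_eq_finsupp_supported]
  rw [(AddMonoidAlgebra.supportedEquivFinsupp (S := ℂ) (R := ℂ) {d : Fin 3 →₀ ℕ | d.degree = e}).finrank_eq]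
  have hset : {d : Fin 3 →₀ ℕ | d.degree = e} =
      ((Finset.univ : Finset (Fin 3)).finsuppAntidiag e : Set (Fin 3 →₀ ℕ)) := by
    ext d
    simp [Finsupp.degree_eq_sum]
  rw [hset, Module.finrank_finsupp_self]
  simp only [SetLike.coe_sort_coe, Fintype.card_coe]
  rw [Finset.card_finsuppAntidiag_nat_eq_choose]
  simp
  rw [add_comm 2 e]
  exact Nat.choose_symm_add

lemma finrank_S_add (e : ℕ) :
    Module.finrank ℂ (homogeneousSubmodule (Fin 3) ℂ (e + 3)) =
      Module.finrank ℂ (homogeneousSubmodule (Fin 3) ℂ e) + 3 * (e + 3) := by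
  rw [finrank_S, finrank_S]
  simp only [Nat.choose_succ_succ' _ 1, Nat.choose_one_right]
  omega

lemma exists_form (e : ℕ) (s : Finset (Pt 2)) (h : s.card < (e + 2).choose 2) :
    ∃ F : MvPolynomial (Fin 3) ℂ, F.IsHomogeneous e ∧ F ≠ 0 ∧ ∀ P ∈ s, eval P.rep F = 0 := by
  have h1 := LinearMap.ker_ne_bot_of_finrank_lt (f := evalMap s e) (by
    rw [finrank_S]; simpa using h)
  obtain ⟨F, hF, hne⟩ := Submodule.exists_mem_ne_zero_of_ne_bot h1
  refine ⟨F.1, (mem_homogeneousSubmodule _ _).1 F.2, fun h => hne (Subtype.ext h), fun P hP => ?_⟩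
  exact congrFun (LinearMap.mem_ker.1 hF) ⟨P, hP⟩

lemma rel_card : ∀ (d : ℕ) (Z : Finset (Pt 2)), IsRel d Z → Z.Nonempty → d + 2 ≤ Z.card := by
  intro d
  induction d with
  | zero =>
    rintro Z ⟨l, hl, hr⟩ hne
    by_contra! hlt
    have : Z.card = 1 := by have := hne.card_pos; omega
    obtain ⟨P, rfl⟩ := Finset.card_eq_one.1 this
    have := hr 1 (isHomogeneous_one _ _)
    simp at this
    exact hl P (by simp) this
  | succ d ih =>
    intro Z h hne
    have h2 := ih Z h.pred hne
    obtain ⟨P, hP, Q, hQ, hPQ⟩ := Finset.one_lt_card.1 (show 1 < Z.card by omega)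
    obtain ⟨G, hG, hp, hq⟩ := exists_sep hPQ
    have h3 := ih _ (h.resid hG) ⟨P, mem_off.2 ⟨hP, hp⟩⟩
    have h4 := on_add_off Z G
    have h5 : 0 < (On Z G).card := Finset.card_pos.2 ⟨Q, mem_on.2 ⟨hQ, hq⟩⟩
    omega

lemma LGP.off_of {Z : Finset (Pt 2)} (h : LGP Z) {F : MvPolynomial (Fin 3) ℂ}
    (hF : F.IsHomogeneous 1) (h0 : F ≠ 0) {P Q R : Pt 2} (hP : P ∈ Z) (hQ : Q ∈ Z) (hR : R ∈ Z)
    (hPQ : P ≠ Q) (hPR : P ≠ R) (hQR : Q ≠ R) (h1 : eval P.rep F = 0) (h2 : eval Q.rep F = 0) :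
    eval R.rep F ≠ 0 := by
  intro h3
  have := h F hF h0
  have h4 : ({P, Q, R} : Finset (Pt 2)) ⊆ On Z F := by
    intro x hx
    simp only [Finset.mem_insert, Finset.mem_singleton] at hx
    rcases hx with rfl | rfl | rfl <;> exact mem_on.2 ⟨‹_›, ‹_›⟩
  have h5 := Finset.card_le_card h4
  rw [Finset.card_eq_three.2 ⟨P, Q, R, hPQ, hPR, hQR, rfl⟩] at h5
  omega

lemma rel_card_lgp : ∀ (d : ℕ) (Z : Finset (Pt 2)), IsRel d Z → LGP Z → Z.Nonempty →
    2 * d + 2 ≤ Z.card := by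
  intro d
  induction d with
  | zero => exact fun Z h _ hne => by simpa using rel_card 0 Z h hne
  | succ d ih =>
    intro Z h hl hne
    have h2 := rel_card _ Z h hne
    obtain ⟨P, Q, R, hP, hQ, hR, hPQ, hPR, hQR⟩ :=
      Finset.two_lt_card_iff.1 (show 2 < Z.card by omega)
    obtain ⟨G, hG, h0, hv⟩ := exists_form 1 {P, Q} (by
      have := Finset.card_le_two (a := P) (b := Q)
      have : (1 + 2).choose 2 = 3 := rfl
      omega)
    have hp := hv P (by simp)
    have hq := hv Q (by simp)
    have hr := hl.off_of hG h0 hP hQ hR hPQ hPR hQR hp hq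
    have h3 := ih _ (h.resid hG) (hl.mono (Finset.filter_subset _ _)) ⟨R, mem_off.2 ⟨hR, hr⟩⟩
    have h4 := on_add_off Z G
    have h5 : 1 < (On Z G).card :=
      Finset.one_lt_card.2 ⟨P, mem_on.2 ⟨hP, hp⟩, Q, mem_on.2 ⟨hQ, hq⟩, hPQ⟩
    omega

lemma hom_succ {e : ℕ} {F : MvPolynomial (Fin 3) ℂ} (hF : F.IsHomogeneous (e + 1)) :
    ∃ G : Fin 3 → MvPolynomial (Fin 3) ℂ, (∀ i, (G i).IsHomogeneous e) ∧ F = ∑ i, X i * G i := by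
  refine ⟨fun i => C ((e + 1 : ℂ)⁻¹) * pderiv i F, fun i => ?_, ?_⟩
  · have := (isHomogeneous_C (Fin 3) ((e + 1 : ℂ)⁻¹)).mul (hF.pderiv (i := i))
    simpa using this
  · have h := hF.sum_X_mul_pderiv
    have hne : (e + 1 : ℂ) ≠ 0 := by exact_mod_cast Nat.succ_ne_zero e
    calc F = C ((e + 1 : ℂ)⁻¹) * ((e + 1) • F) := by
            rw [← smul_eq_C_mul, ← Nat.cast_smul_eq_nsmul ℂ, smul_smul]
            push_cast
            rw [inv_mul_cancel₀ hne, one_smul]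
      _ = _ := by
        rw [← h, Finset.mul_sum]
        exact Finset.sum_congr rfl fun i _ => by ring

lemma hom_one {F : MvPolynomial (Fin 3) ℂ} (hF : F.IsHomogeneous 1) :
    ∃ v : Fin 3 → ℂ, F = linForm (m := 2) v := by
  obtain ⟨G, hG, h⟩ := hom_succ (e := 0) hF
  refine ⟨fun i => (G i).coeff 0, ?_⟩
  rw [h, linForm]
  refine Finset.sum_congr rfl fun i _ => ?_
  have : G i = C ((G i).coeff 0) := by
    refine totalDegree_eq_zero_iff_eq_C.1 ?_
    have := (hG i).totalDegree_le
    omega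
  rw [mul_comm, ← this]

lemma hom_two {F : MvPolynomial (Fin 3) ℂ} (hF : F.IsHomogeneous 2) :
    ∃ b : (Fin 3 → ℂ) →ₗ[ℂ] (Fin 3 → ℂ) →ₗ[ℂ] ℂ, (∀ x y, b x y = b y x) ∧
      ∀ x, eval x F = b x x := by
  obtain ⟨G, hG, h⟩ := hom_succ (e := 1) hF
  choose v hv using fun i => hom_one (hG i)
  refine ⟨LinearMap.mk₂ ℂ (fun x y => ∑ i, ∑ j, (v i j + v j i) / 2 * x i * y j) ?_ ?_ ?_ ?_, ?_, ?_⟩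
  · intro x x' y
    simp only [Fin.sum_univ_three, Pi.add_apply]; ring
  · intro c x y
    simp only [Fin.sum_univ_three, Pi.smul_apply, smul_eq_mul]; ring
  · intro x x' y
    simp only [Fin.sum_univ_three, Pi.add_apply]; ring
  · intro c x y
    simp only [Fin.sum_univ_three, Pi.smul_apply, smul_eq_mul]; ring
  · intro x y
    simp only [LinearMap.mk₂_apply, Fin.sum_univ_three]; ring
  · intro x
    rw [h]
    simp only [LinearMap.mk₂_apply, map_add, map_mul, eval_X, hv, eval_linForm, Fin.sum_univ_three]
    ring

lemma indep_pair {P Q : Pt 2} (h : P ≠ Q) : LinearIndependent ℂ ![P.rep, Q.rep] := by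
  have h1 := (Projectivization.independent_pair_iff_ne P Q).2 h
  rw [Projectivization.independent_iff] at h1
  have h2 : ![P.rep, Q.rep] = Projectivization.rep ∘ ![P, Q] := by
    funext i; fin_cases i <;> rfl
  rw [h2]
  exact h1

/-- The linear functional of a coefficient vector. -/
def lf (v : Fin 3 → ℂ) : (Fin 3 → ℂ) →ₗ[ℂ] ℂ where
  toFun x := ∑ i, v i * x i
  map_add' x y := by simp [mul_add, Finset.sum_add_distrib]
  map_smul' c x := by simp only [Fin.sum_univ_three, Pi.smul_apply, smul_eq_mul, RingHom.id_apply]; ring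

lemma eval_lf (v x : Fin 3 → ℂ) : eval x (linForm (m := 2) v) = lf v x := eval_linForm v x

lemma lf_ne_zero {v : Fin 3 → ℂ} (h : linForm (m := 2) v ≠ 0) : lf v ≠ 0 := by
  intro h0
  obtain ⟨x, hx⟩ := exists_eval_ne h
  rw [eval_lf, h0] at hx
  exact hx rfl

lemma span_line {v : Fin 3 → ℂ} (h : linForm (m := 2) v ≠ 0) {P Q : Pt 2} (hPQ : P ≠ Q)
    (hP : lf v P.rep = 0) (hQ : lf v Q.rep = 0) {x : Fin 3 → ℂ} (hx : lf v x = 0) :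
    ∃ a b : ℂ, a • P.rep + b • Q.rep = x := by
  have h1 := Module.Dual.finrank_ker_add_one_of_ne_zero (f := lf v) (lf_ne_zero h)
  have h2 := finrank_span_eq_card (indep_pair hPQ)
  have h3 : Submodule.span ℂ (Set.range ![P.rep, Q.rep]) = LinearMap.ker (lf v) := by
    apply Submodule.eq_of_le_of_finrank_eq
    · rw [Submodule.span_le]
      rintro _ ⟨i, rfl⟩
      fin_cases i
      · exact hP
      · exact hQ
    · rw [h2]; simp at h1 ⊢; omega
  have h4 : x ∈ Submodule.span ℂ (Set.range ![P.rep, Q.rep]) := by rw [h3]; exact hx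
  simp only [Matrix.range_cons, Matrix.range_empty, Set.union_empty, Set.singleton_union] at h4
  exact Submodule.mem_span_pair.1 h4

lemma rep_smul_ne {P Q : Pt 2} (h : P ≠ Q) (a : ℂ) : a • P.rep ≠ Q.rep := by
  intro h2
  apply h
  rw [← P.mk_rep, ← Q.mk_rep, eq_comm, Projectivization.mk_eq_mk_iff']
  exact ⟨a, h2⟩

lemma conic_line {q F : MvPolynomial (Fin 3) ℂ} (hq : q.IsHomogeneous 2) (hq0 : q ≠ 0)
    (hF : F.IsHomogeneous 1) (hF0 : F ≠ 0) {P Q R : Pt 2}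
    (hPQ : P ≠ Q) (hPR : P ≠ R) (hQR : Q ≠ R)
    (hP : eval P.rep F = 0) (hQ : eval Q.rep F = 0) (hR : eval R.rep F = 0)
    (hP2 : eval P.rep q = 0) (hQ2 : eval Q.rep q = 0) (hR2 : eval R.rep q = 0) :
    ∃ G : MvPolynomial (Fin 3) ℂ, G.IsHomogeneous 1 ∧ G ≠ 0 ∧
      ∀ x, eval x q = eval x F * eval x G := by
  obtain ⟨v, rfl⟩ := hom_one hF
  obtain ⟨b, hs, hb⟩ := hom_two hq
  rw [eval_lf] at hP hQ hR
  rw [hb] at hP2 hQ2 hR2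
  have hbPQ : b P.rep Q.rep = 0 := by
    obtain ⟨s, t, hst⟩ := span_line hF0 hPQ hP hQ hR
    have hs0 : s ≠ 0 := by
      rintro rfl
      exact rep_smul_ne hQR t (by simpa using hst)
    have ht0 : t ≠ 0 := by
      rintro rfl
      exact rep_smul_ne hPR s (by simpa using hst)
    rw [← hst] at hR2
    simp only [map_add, map_smul, LinearMap.add_apply, LinearMap.smul_apply, smul_eq_mul, hP2, hQ2,
      hs Q.rep P.rep] at hR2
    have : 2 * (s * t) * b P.rep Q.rep = 0 := by linear_combination hR2
    simpa [hs0, ht0] using this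
  have hz : ∀ x, lf v x = 0 → b x x = 0 := by
    intro x hx
    obtain ⟨s, t, hst⟩ := span_line hF0 hPQ hP hQ hx
    rw [← hst]
    simp only [map_add, map_smul, LinearMap.add_apply, LinearMap.smul_apply, smul_eq_mul, hP2, hQ2,
      hs Q.rep P.rep, hbPQ]
    ring
  obtain ⟨u, hu⟩ := exists_eval_ne hF0
  rw [eval_lf] at hu
  let w : Fin 3 → ℂ := fun i => 2 * (lf v u)⁻¹ * b u (Pi.single i 1) - (lf v u)⁻¹ ^ 2 * b u u * v i
  have hw : ∀ x, eval x (linForm (m := 2) w) =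
      2 * (lf v u)⁻¹ * b u x - (lf v u)⁻¹ ^ 2 * b u u * lf v x := by
    intro x
    rw [eval_linForm]
    have h1 : b u x = ∑ i, b u (Pi.single i 1) * x i := by
      conv_lhs => rw [show x = ∑ i, x i • Pi.single i (1 : ℂ) from (pi_eq_sum_univ' x)]
      simp [mul_comm]
    rw [h1]
    simp only [lf, LinearMap.coe_mk, AddHom.coe_mk, Fin.sum_univ_three, w]
    ring
  have key : ∀ x, eval x q = eval x (linForm (m := 2) v) * eval x (linForm (m := 2) w) := by
    intro x
    have := hz (x - (lf v x * (lf v u)⁻¹) • u) (by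
      simp only [map_sub, map_smul, smul_eq_mul]
      field_simp; ring)
    simp only [map_sub, map_smul, LinearMap.sub_apply, LinearMap.smul_apply, smul_eq_mul, hs x u]
      at this
    rw [hw, hb, eval_lf]
    linear_combination this
  refine ⟨linForm (m := 2) w, linForm_hom w, fun h => ?_, key⟩
  apply hq0
  refine MvPolynomial.funext fun x => ?_
  rw [key, h]; simp

lemma hc_mul {a : ℕ} (b : ℕ) {E : MvPolynomial (Fin 3) ℂ} (hE : E.IsHomogeneous a)
    (F : MvPolynomial (Fin 3) ℂ) :
    homogeneousComponent (a + b) (E * F) = E * homogeneousComponent b F := by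
  have h1 : ∀ i, homogeneousComponent (a + b) (E * homogeneousComponent i F) =
      if b = i then E * homogeneousComponent i F else 0 := by
    intro i
    rw [homogeneousComponent_of_mem (n := a + i)
      (hE.mul (homogeneousComponent_isHomogeneous i F))]
    simp
  conv_lhs => rw [← sum_homogeneousComponent F, Finset.mul_sum, map_sum]
  simp only [h1, Finset.sum_ite_eq, Finset.mem_range]
  split_ifs with h
  · rfl
  · rw [homogeneousComponent_eq_zero _ _ (by omega), mul_zero]

lemma hom_of_mul {a b : ℕ} {E F : MvPolynomial (Fin 3) ℂ} (hE : E.IsHomogeneous a) (h0 : E ≠ 0)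
    (h : (E * F).IsHomogeneous (a + b)) : F.IsHomogeneous b := by
  have h1 := hc_mul b hE F
  rw [homogeneousComponent_eq_self h] at h1
  rw [mul_left_cancel₀ h0 h1]
  exact homogeneousComponent_isHomogeneous b F

lemma hc_top_mul (G H : MvPolynomial (Fin 3) ℂ) :
    homogeneousComponent (G.totalDegree + H.totalDegree) (G * H) =
      homogeneousComponent G.totalDegree G * homogeneousComponent H.totalDegree H := by
  have h1 : G * H = (∑ i ∈ Finset.range (G.totalDegree + 1), homogeneousComponent i G) * H := by
    rw [sum_homogeneousComponent]
  rw [h1, Finset.sum_mul, map_sum, Finset.sum_range_succ, hc_mul _ (homogeneousComponent_isHomogeneous _ G)]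
  rw [Finset.sum_eq_zero, zero_add]
  intro i hi
  rw [Finset.mem_range] at hi
  rw [show G.totalDegree + H.totalDegree = i + (G.totalDegree + H.totalDegree - i) by omega,
    hc_mul _ (homogeneousComponent_isHomogeneous _ G),
    homogeneousComponent_eq_zero _ H (by omega), mul_zero]

lemma cubic_cases {E : MvPolynomial (Fin 3) ℂ} (hE : E.IsHomogeneous 3) (h0 : E ≠ 0) :
    Prime E ∨ ∃ L Q : MvPolynomial (Fin 3) ℂ, L.IsHomogeneous 1 ∧ Q.IsHomogeneous 2 ∧
      L ≠ 0 ∧ Q ≠ 0 ∧ E = L * Q := by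
  by_cases hi : Irreducible E
  · exact Or.inl hi.prime
  right
  have hu : ∀ G : MvPolynomial (Fin 3) ℂ, G ≠ 0 → ¬ IsUnit G → G.totalDegree ≠ 0 := by
    intro G hG hn h
    apply hn
    rw [totalDegree_eq_zero_iff_eq_C] at h
    rw [h]
    refine IsUnit.map C (isUnit_iff_ne_zero.2 fun h2 => hG ?_)
    rw [h, h2, C_0]
  have hd : E.totalDegree = 3 := hE.totalDegree h0
  have hnu : ¬ IsUnit E := by
    intro h
    obtain ⟨_, h⟩ := MvPolynomial.isUnit_iff_totalDegree_of_isReduced.1 h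
    omega
  rw [irreducible_iff] at hi
  push Not at hi
  obtain ⟨G, H, rfl, hG, hH⟩ := hi hnu
  have hG0 := left_ne_zero_of_mul h0
  have hH0 := right_ne_zero_of_mul h0
  have h1 := hu G hG0 hG
  have h2 := hu H hH0 hH
  rw [totalDegree_mul_of_isDomain hG0 hH0] at hd
  have h3 := hc_top_mul G H
  rw [hd, homogeneousComponent_eq_self hE] at h3
  have hne := h0
  rw [h3] at hne
  have hG1 := homogeneousComponent_isHomogeneous G.totalDegree G
  have hH1 := homogeneousComponent_isHomogeneous H.totalDegree H
  obtain h | h : G.totalDegree = 1 ∨ G.totalDegree = 2 := by omega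
  · have h' : H.totalDegree = 2 := by omega
    rw [h] at hG1
    rw [h'] at hH1
    rw [h, h'] at h3 hne
    exact ⟨_, _, hG1, hH1, left_ne_zero_of_mul hne, right_ne_zero_of_mul hne, h3⟩
  · have h' : H.totalDegree = 1 := by omega
    rw [h] at hG1
    rw [h'] at hH1
    rw [h, h'] at h3 hne
    exact ⟨_, _, hH1, hG1, right_ne_zero_of_mul hne, left_ne_zero_of_mul hne, by rw [h3, mul_comm]⟩

lemma evalMap_surj (Z : Finset (Pt 2)) (k : ℕ) (hk : Z.card ≤ k) :
    Function.Surjective (evalMap Z k) := by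
  rw [← LinearMap.range_eq_top, eq_top_iff, ← (Pi.basisFun ℂ Z).span_eq, Submodule.span_le]
  rintro _ ⟨⟨P, hP⟩, rfl⟩
  have h1 : ∀ Q : Pt 2, ∃ G : MvPolynomial (Fin 3) ℂ, G.IsHomogeneous 1 ∧ eval P.rep G ≠ 0 ∧
      (P ≠ Q → eval Q.rep G = 0) := by
    intro Q
    by_cases h : P = Q
    · obtain ⟨G, hG, hn⟩ := exists_generic {P}
      exact ⟨G, hG, hn P (by simp), fun h' => (h' h).elim⟩
    · obtain ⟨G, hG, h1, h2⟩ := exists_sep h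
      exact ⟨G, hG, h1, fun _ => h2⟩
  choose G hG hGP hGQ using h1
  let F := (∏ Q ∈ Z, G Q) * (G P) ^ (k - Z.card)
  have hF : F.IsHomogeneous k := by
    have := (IsHomogeneous.prod Z G (fun _ => 1) fun Q _ => hG Q).mul ((hG P).pow (k - Z.card))
    simp only [Finset.sum_const, smul_eq_mul, mul_one, one_mul] at this
    rwa [show Z.card + (k - Z.card) = k by omega] at this
  have hFP : eval P.rep F ≠ 0 := by
    simp only [F, map_mul, map_prod, map_pow]
    exact mul_ne_zero (Finset.prod_ne_zero_iff.2 fun Q _ => hGP Q) (pow_ne_zero _ (hGP P))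
  have hFQ : ∀ Q ∈ Z, P ≠ Q → eval Q.rep F = 0 := by
    intro Q hQ h
    simp only [F, map_mul, map_prod, map_pow]
    rw [Finset.prod_eq_zero hQ (hGQ Q h), zero_mul]
  refine ⟨(eval P.rep F)⁻¹ • ⟨F, hF⟩, ?_⟩
  rw [map_smul]
  funext ⟨Q, hQ⟩
  simp only [evalMap, LinearMap.coe_mk, AddHom.coe_mk, Pi.smul_apply, smul_eq_mul,
    Pi.basisFun_apply, Pi.single_apply, Subtype.mk.injEq]
  split_ifs with h
  · subst h; exact inv_mul_cancel₀ hFP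
  · rw [hFQ Q hQ (Ne.symm h), mul_zero]

lemma pairing {a b : ℕ} {Z : Finset (Pt 2)} (h : IsRel (a + b) Z) : hf Z a + hf Z b ≤ Z.card := by
  obtain ⟨l, hl, hr⟩ := h
  let Φ : (Z → ℂ) →ₗ[ℂ] Module.Dual ℂ (Z → ℂ) := LinearMap.mk₂ ℂ (fun f g => ∑ P : Z, l P * f P * g P)
    (fun f f' g => by simp [mul_add, add_mul, Finset.sum_add_distrib])
    (fun c f g => by
      simp only [Pi.smul_apply, smul_eq_mul, Finset.mul_sum]
      exact Finset.sum_congr rfl fun P _ => by ring)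
    (fun f g g' => by simp [mul_add, Finset.sum_add_distrib])
    (fun c f g => by
      simp only [Pi.smul_apply, smul_eq_mul, Finset.mul_sum]
      exact Finset.sum_congr rfl fun P _ => by ring)
  have hΦ : Function.Injective Φ := by
    rw [← LinearMap.ker_eq_bot, LinearMap.ker_eq_bot']
    intro f hf
    funext P
    have : ∑ Q : Z, l Q * f Q * (Pi.single P 1 : Z → ℂ) Q = 0 :=
      LinearMap.congr_fun hf (Pi.single P 1)
    rw [Finset.sum_eq_single P (fun Q _ h => by rw [Pi.single_eq_of_ne h, mul_zero])
      (fun h => (h (Finset.mem_univ _)).elim), Pi.single_eq_same, mul_one] at this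
    simpa [hl P.1 P.2] using this
  have hle : (LinearMap.range (evalMap Z a)).map Φ ≤
      (LinearMap.range (evalMap Z b)).dualAnnihilator := by
    rintro _ ⟨_, ⟨F, rfl⟩, rfl⟩
    rw [Submodule.mem_dualAnnihilator]
    rintro _ ⟨G, rfl⟩
    have := hr (F.1 * G.1) (IsHomogeneous.mul F.2 G.2)
    rw [← Finset.sum_coe_sort Z] at this
    simpa [Φ, evalMap, mul_assoc] using this
  have h1 := Submodule.finrank_mono hle
  rw [← (Submodule.equivMapOfInjective Φ hΦ _).finrank_eq] at h1
  have h2 := Subspace.finrank_add_finrank_dualAnnihilator_eq (LinearMap.range (evalMap Z b))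
  simp only [Module.finrank_fintype_fun_eq_card, Fintype.card_coe] at h2
  unfold hf
  omega

/-- Multiplication by a form. -/
def mulS {a : ℕ} {E : MvPolynomial (Fin 3) ℂ} (hE : E.IsHomogeneous a) (b c : ℕ) (h : a + b = c) :
    homogeneousSubmodule (Fin 3) ℂ b →ₗ[ℂ] homogeneousSubmodule (Fin 3) ℂ c :=
  (LinearMap.mulLeft ℂ E).restrict (fun F hF => by
    subst h
    exact IsHomogeneous.mul hE hF)

lemma mulS_coe {a : ℕ} {E : MvPolynomial (Fin 3) ℂ} (hE : E.IsHomogeneous a) (b c : ℕ)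
    (h : a + b = c) (F) : (mulS hE b c h F).1 = E * F.1 := rfl

lemma bezout {e : ℕ} {E F : MvPolynomial (Fin 3) ℂ} (hE : E.IsHomogeneous 3) (hp : Prime E)
    (hF : F.IsHomogeneous e) (hdiv : ¬ E ∣ F) (Z : Finset (Pt 2))
    (hZE : ∀ P ∈ Z, eval P.rep E = 0) (hZF : ∀ P ∈ Z, eval P.rep F = 0) : Z.card ≤ 3 * e := by
  set j := Z.card with hj
  let ψ := (mulS hE (e + j) (e + j + 3) (by omega)).coprod (mulS hF (j + 3) (e + j + 3) (by omega))
  let χ := (-(mulS hF j (e + j) rfl)).prod (mulS hE j (j + 3) (by omega))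
  have hk : LinearMap.ker ψ ≤ LinearMap.range χ := by
    rintro ⟨B, A⟩ hBA
    have h1 : E * B.1 + F * A.1 = 0 := congrArg Subtype.val (LinearMap.mem_ker.1 hBA)
    have h2 : E ∣ F * A.1 := ⟨-B.1, by linear_combination h1⟩
    obtain ⟨A', hA'⟩ := (hp.dvd_or_dvd h2).resolve_left hdiv
    have hhom : A'.IsHomogeneous j := by
      refine hom_of_mul hE hp.ne_zero ?_
      have h4 : A.1.IsHomogeneous (j + 3) := A.2
      rw [hA'] at h4
      rwa [add_comm]
    refine ⟨⟨A', hhom⟩, Prod.ext (Subtype.ext ?_) (Subtype.ext hA'.symm)⟩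
    show -(F * A') = B.1
    apply mul_left_cancel₀ hp.ne_zero
    rw [hA'] at h1
    linear_combination -h1
  have hr : LinearMap.range ψ ≤ LinearMap.ker (evalMap Z (e + j + 3)) := by
    rintro _ ⟨⟨B, A⟩, rfl⟩
    rw [LinearMap.mem_ker]
    funext ⟨P, hP⟩
    show eval P.rep (E * B.1 + F * A.1) = 0
    rw [map_add, map_mul, map_mul, hZE P hP, hZF P hP]; ring
  have h1 := Submodule.finrank_mono hk
  have h2 := LinearMap.finrank_range_le χ
  have h3 := Submodule.finrank_mono hr
  have h4 := LinearMap.finrank_range_add_finrank_ker ψ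
  have h5 := LinearMap.finrank_range_add_finrank_ker (evalMap Z (e + j + 3))
  rw [LinearMap.range_eq_top.2 (evalMap_surj Z _ (by omega)), finrank_top,
    Module.finrank_fintype_fun_eq_card, Fintype.card_coe] at h5
  rw [Module.finrank_prod] at h4
  have h6 := finrank_S_add (e + j)
  have h7 := finrank_S_add j
  simp only [Nat.reduceAdd] at *
  omega

/-- Conclusion of the structure theorem. -/
def Concl (Z : Finset (Pt 2)) : Prop :=
  (∃ L M : MvPolynomial (Fin 3) ℂ, L.IsHomogeneous 1 ∧ L ≠ 0 ∧ M.IsHomogeneous 1 ∧ M ≠ 0 ∧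
    ∀ P ∈ Z, eval P.rep L = 0 ∨ eval P.rep M = 0) ∨
  (LGP Z ∧ ∃ q : MvPolynomial (Fin 3) ℂ, q.IsHomogeneous 2 ∧ q ≠ 0 ∧ ∀ P ∈ Z, eval P.rep q = 0)

lemma Concl.conic {Z : Finset (Pt 2)} (h : Concl Z) :
    ∃ q : MvPolynomial (Fin 3) ℂ, q.IsHomogeneous 2 ∧ q ≠ 0 ∧ ∀ P ∈ Z, eval P.rep q = 0 := by
  rcases h with ⟨L, M, hL, hL0, hM, hM0, h⟩ | ⟨_, h⟩
  · refine ⟨L * M, hL.mul hM, mul_ne_zero hL0 hM0, fun P hP => ?_⟩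
    rw [map_mul]
    exact mul_eq_zero.2 (h P hP)
  · exact h

lemma off_empty {Z : Finset (Pt 2)} {F : MvPolynomial (Fin 3) ℂ} (h : ¬ (Off Z F).Nonempty) :
    ∀ P ∈ Z, eval P.rep F = 0 := by
  intro P hP
  by_contra h2
  exact h ⟨P, mem_off.2 ⟨hP, h2⟩⟩

lemma cover_of {Z : Finset (Pt 2)} {L M : MvPolynomial (Fin 3) ℂ} (hL : L.IsHomogeneous 1)
    (hL0 : L ≠ 0) (hM : M.IsHomogeneous 1) (hM0 : M ≠ 0) (h : ¬ (Off Z (L * M)).Nonempty) :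
    Concl Z := by
  refine Or.inl ⟨L, M, hL, hL0, hM, hM0, fun P hP => ?_⟩
  have := off_empty h P hP
  rw [map_mul] at this
  exact mul_eq_zero.1 this

lemma disj_card {Z A B : Finset (Pt 2)} (hA : A ⊆ Z) (hB : B ⊆ Z) (h : ∀ P ∈ A, P ∉ B) :
    A.card + B.card ≤ Z.card := by
  rw [← Finset.card_union_of_disjoint (Finset.disjoint_left.2 h)]
  exact Finset.card_le_card (Finset.union_subset hA hB)

lemma off_sub (Z : Finset (Pt 2)) (F) : Off Z F ⊆ Z := Finset.filter_subset _ _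
lemma on_sub (Z : Finset (Pt 2)) (F) : On Z F ⊆ Z := Finset.filter_subset _ _

lemma lineCase {e : ℕ} {Z : Finset (Pt 2)} (h : IsRel (e + 2) Z) (hc : Z.card + 1 ≤ 3 * (e + 2))
    {L : MvPolynomial (Fin 3) ℂ} (hL : L.IsHomogeneous 1) (hL0 : L ≠ 0)
    (h3 : 3 ≤ (On Z L).card) (hI : Concl (Off Z L)) : Concl Z := by
  rcases hI with ⟨M, N, hM, hM0, hN, hN0, hI⟩ | ⟨hlg, q, hq, hq0, hI⟩
  · by_contra hcon
    have h1 : (Off Z (L * M)).Nonempty := by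
      by_contra h'; exact hcon (cover_of hL hL0 hM hM0 h')
    have h2 : (Off Z (L * N)).Nonempty := by
      by_contra h'; exact hcon (cover_of hL hL0 hN hN0 h')
    have h3 : (Off Z (M * N)).Nonempty := by
      by_contra h'; exact hcon (cover_of hM hM0 hN hN0 h')
    have c1 := rel_card _ _ (h.resid (hL.mul hM)) h1
    have c2 := rel_card _ _ (h.resid (hL.mul hN)) h2
    have c3 := rel_card _ _ (h.resid (hM.mul hN)) h3
    have d1 : (Off Z (L * M)).card + (Off Z (L * N)).card =
        (Off Z (L * M) ∪ Off Z (L * N)).card := by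
      rw [Finset.card_union_of_disjoint]
      rw [Finset.disjoint_left]
      intro P hP hP2
      rw [mem_off, map_mul, mul_ne_zero_iff] at hP hP2
      rcases hI P (mem_off.2 ⟨hP.1, hP.2.1⟩) with h | h
      · exact hP.2.2 h
      · exact hP2.2.2 h
    have d2 := disj_card (Z := Z) (Finset.union_subset (off_sub Z (L * M)) (off_sub Z (L * N)))
      (off_sub Z (M * N)) (by
        intro P hP hP2
        rw [mem_off, map_mul, mul_ne_zero_iff] at hP2
        have hP3 : eval P.rep L ≠ 0 := by
          rcases Finset.mem_union.1 hP with hP | hP <;>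
          · rw [mem_off, map_mul, mul_ne_zero_iff] at hP
            exact hP.2.1
        rcases hI P (mem_off.2 ⟨hP2.1, hP3⟩) with h | h
        · exact hP2.2.1 h
        · exact hP2.2.2 h)
    omega
  · by_cases h1 : (Off Z L).Nonempty
    · have c1 := rel_card_lgp (e + 1) _ (IsRel.resid (d := e + 1) h hL) hlg h1
      by_cases h2 : (Off Z q).Nonempty
      · have c2 := rel_card _ _ (h.resid hq) h2
        have := disj_card (off_sub Z L) (off_sub Z q) (fun P hP hP2 =>
          (mem_off.1 hP2).2 (hI P hP))
        omega
      · have h4 := off_empty h2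
        obtain ⟨P, Q, R, hP, hQ, hR, hPQ, hPR, hQR⟩ := Finset.two_lt_card_iff.1 h3
        rw [mem_on] at hP hQ hR
        obtain ⟨G, hG, hG0, hGq⟩ := conic_line hq hq0 hL hL0 hPQ hPR hQR hP.2 hQ.2 hR.2
          (h4 P hP.1) (h4 Q hQ.1) (h4 R hR.1)
        refine Or.inl ⟨L, G, hL, hL0, hG, hG0, fun P hP => ?_⟩
        rw [← mul_eq_zero, ← hGq]
        exact h4 P hP
    · exact Or.inl ⟨L, L, hL, hL0, hL, hL0, fun P hP => Or.inl (off_empty h1 P hP)⟩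

lemma card_le_on {Z s : Finset (Pt 2)} {F : MvPolynomial (Fin 3) ℂ} (hs : s ⊆ Z)
    (h : ∀ P ∈ s, eval P.rep F = 0) : s.card ≤ (On Z F).card :=
  Finset.card_le_card fun P hP => mem_on.2 ⟨hs hP, h P hP⟩

lemma hf_of_inj {Z : Finset (Pt 2)} (hno : ∀ q : MvPolynomial (Fin 3) ℂ, q.IsHomogeneous 2 → q ≠ 0 →
    (Off Z q).Nonempty) : hf Z 2 = 6 := by
  have h1 : LinearMap.ker (evalMap Z 2) = ⊥ := by
    rw [LinearMap.ker_eq_bot']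
    intro q hq
    by_contra h0
    obtain ⟨P, hP⟩ := hno q.1 q.2 (fun h => h0 (Subtype.ext h))
    rw [mem_off] at hP
    exact hP.2 (congrFun hq ⟨P, hP.1⟩)
  have h2 := LinearMap.finrank_range_add_finrank_ker (evalMap Z 2)
  rw [h1, finrank_bot, finrank_S] at h2
  exact h2

lemma hf_cubic {Z : Finset (Pt 2)} {E : MvPolynomial (Fin 3) ℂ} (hE : E.IsHomogeneous 3)
    (hp : Prime E) (hZ : ∀ P ∈ Z, eval P.rep E = 0) (g : ℕ) (hc : 3 * (g + 3) < Z.card) :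
    3 * (g + 3) ≤ hf Z (g + 3) := by
  have hk : LinearMap.ker (evalMap Z (g + 3)) ≤ LinearMap.range (mulS hE g (g + 3) (by omega)) := by
    intro F hF
    have hdiv : E ∣ F.1 := by
      by_contra hd
      have := bezout hE hp F.2 hd Z hZ (fun P hP => congrFun (LinearMap.mem_ker.1 hF) ⟨P, hP⟩)
      omega
    obtain ⟨G, hG⟩ := hdiv
    have hhom : G.IsHomogeneous g := by
      refine hom_of_mul hE hp.ne_zero ?_
      have h4 : F.1.IsHomogeneous (g + 3) := F.2
      rw [hG] at h4
      rwa [add_comm]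
    exact ⟨⟨G, hhom⟩, Subtype.ext hG.symm⟩
  have h1 := Submodule.finrank_mono hk
  have h2 := LinearMap.finrank_range_le (mulS hE g (g + 3) (by omega))
  have h3 := LinearMap.finrank_range_add_finrank_ker (evalMap Z (g + 3))
  have h4 := finrank_S_add g
  unfold hf
  simp only [Nat.reduceAdd] at *
  omega

lemma lgpCase {d : ℕ} (ih : ∀ e < d, ∀ Z : Finset (Pt 2), IsRel e Z → Z.card + 1 ≤ 3 * e → Concl Z)
    {Z : Finset (Pt 2)} (h : IsRel d Z) (hl : LGP Z) (hne : Z.Nonempty) (hc : Z.card + 1 ≤ 3 * d) :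
    ∃ q : MvPolynomial (Fin 3) ℂ, q.IsHomogeneous 2 ∧ q ≠ 0 ∧ ∀ P ∈ Z, eval P.rep q = 0 := by
  by_contra hcon
  have hno : ∀ q : MvPolynomial (Fin 3) ℂ, q.IsHomogeneous 2 → q ≠ 0 → (Off Z q).Nonempty := by
    intro q hq h0
    by_contra h'
    exact hcon ⟨q, hq, h0, off_empty h'⟩
  have c0 := rel_card_lgp d Z h hl hne
  obtain ⟨e, rfl⟩ : ∃ e, d = e + 3 := ⟨d - 3, by omega⟩
  have hoff : ∀ q : MvPolynomial (Fin 3) ℂ, q.IsHomogeneous 2 → q ≠ 0 → 2 * e + 4 ≤ (Off Z q).card :=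
    fun q hq h0 => rel_card_lgp (e + 1) _ (IsRel.resid (d := e + 1) h hq) (hl.mono (off_sub Z q))
      (hno q hq h0)
  have h5 : ∀ q : MvPolynomial (Fin 3) ℂ, q.IsHomogeneous 2 → q ≠ 0 → (On Z q).card ≤ 5 := by
    intro q hq h0
    by_contra! h6
    have c1 := on_add_off Z q
    have c2 := hoff q hq h0
    obtain ⟨q2, hq2, hq20, hv⟩ := (ih (e + 1) (by omega) (Off Z q)
      (IsRel.resid (d := e + 1) h hq) (by omega)).conic
    have c3 := hoff q2 hq2 hq20
    have c4 := disj_card (off_sub Z q) (off_sub Z q2) (fun P hP hP2 =>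
          (mem_off.1 hP2).2 (hv P hP))
    omega
  rcases e with _ | f
  · obtain ⟨s, hs, hs5⟩ := Finset.exists_subset_card_eq (show 5 ≤ Z.card by omega)
    obtain ⟨q, hq, hq0, hv⟩ := exists_form 2 s (by rw [hs5]; decide)
    have c1 := on_add_off Z q
    have c2 := hoff q hq hq0
    have c3 := card_le_on hs hv
    omega
  · obtain ⟨s, hs, hs9⟩ := Finset.exists_subset_card_eq (show 9 ≤ Z.card by omega)
    obtain ⟨E, hE, hE0, hv⟩ := exists_form 3 s (by rw [hs9]; decide)
    have c1 := on_add_off Z E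
    have c3 := card_le_on hs hv
    have hZE : ∀ P ∈ Z, eval P.rep E = 0 := by
      apply off_empty
      intro hoe
      have hrel : IsRel (f + 1) (Off Z E) := IsRel.resid (d := f + 1) h hE
      have c2 := rel_card_lgp (f + 1) _ hrel (hl.mono (off_sub Z E)) hoe
      obtain ⟨q2, hq2, hq20, hv2⟩ := (ih (f + 1) (by omega) (Off Z E) hrel (by omega)).conic
      have c4 := card_le_on (off_sub Z E) hv2
      have c5 := h5 q2 hq2 hq20
      omega
    rcases cubic_cases hE hE0 with hp | ⟨L, Q, hL, hQ, hL0, hQ0, rfl⟩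
    · have c6 : 3 * f + 9 ≤ Z.card := by
        by_contra! hlt
        exact hcon (ih (f + 3) (by omega) Z (IsRel.pred (d := f + 3) h) (by omega)).conic
      have h' : IsRel (2 + (f + 2)) Z := by
        rw [show 2 + (f + 2) = f + 1 + 3 by omega]; exact h
      have c7 := pairing h'
      have c8 := hf_of_inj hno
      have c9 : 3 * (f + 2) ≤ hf Z (f + 2) := by
        rcases f with _ | g
        · simp [c8]
        · exact hf_cubic hE hp hZE g (by omega)
      omega
    · have c6 := hl L hL hL0
      have c7 := h5 Q hQ hQ0
      have c8 : Z ⊆ On Z L ∪ On Z Q := by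
        intro P hP
        have := hZE P hP
        rw [map_mul, mul_eq_zero] at this
        rw [Finset.mem_union, mem_on, mem_on]
        tauto
      have c9 := (Finset.card_le_card c8).trans (Finset.card_union_le _ _)
      omega

lemma structure_thm : ∀ (d : ℕ) (Z : Finset (Pt 2)), IsRel d Z → Z.card + 1 ≤ 3 * d → Concl Z := by
  intro d
  induction d using Nat.strong_induction_on with
  | _ d ih =>
  intro Z h hc
  rcases Z.eq_empty_or_nonempty with rfl | hne
  · obtain ⟨q, hq, hq0, _⟩ := exists_form 1 ∅ (by decide)
    exact Or.inl ⟨q, q, hq, hq0, hq, hq0, by simp⟩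
  have c0 := rel_card d Z h hne
  by_cases hl : LGP Z
  · exact Or.inr ⟨hl, lgpCase ih h hl hne hc⟩
  · unfold LGP at hl
    push Not at hl
    obtain ⟨L, hL, hL0, h3⟩ := hl
    obtain ⟨e, rfl⟩ : ∃ e, d = e + 2 := ⟨d - 2, by omega⟩
    refine lineCase h hc hL hL0 h3 (ih (e + 1) (by omega) _ (IsRel.resid (d := e + 1) h hL) ?_)
    have := on_add_off Z L
    omega

lemma apolar {d : ℕ} {Z : Finset (Pt 2)} {l : Pt 2 → ℂ} (h : ∑ P ∈ Z, l P • powRep d P = 0)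
    {F : MvPolynomial (Fin 3) ℂ} (hF : F.IsHomogeneous d) : ∑ P ∈ Z, l P * eval P.rep F = 0 := by
  have key : ∀ s : Fin 3 →₀ ℕ, s.degree = d → ∑ P ∈ Z, l P * ∏ i, P.rep i ^ s i = 0 := by
    intro s hs
    have h1 := congrArg (coeff s) h
    rw [coeff_sum, coeff_zero] at h1
    have h2 : ∀ P : Pt 2, coeff s (l P • powRep d P) =
        (s.multinomial : ℂ) * (l P * ∏ i, P.rep i ^ s i) := by
      intro P
      have h3 : powRep d P = (∑ i, P.rep i • X i) ^ d := by
        simp only [powRep, linForm, smul_eq_C_mul]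
      have h4 : (s.sum fun _ m => m) = d := by
        rw [← hs]; rfl
      rw [coeff_smul, h3, coeff_linearCombination_X_pow_of_fintype, if_pos h4,
        Finsupp.prod_fintype _ _ (fun i => pow_zero _), smul_eq_mul]
      ring
    simp only [h2] at h1
    rw [← Finset.mul_sum] at h1
    refine (mul_eq_zero.1 h1).resolve_left ?_
    have : s.multinomial ≠ 0 := (Nat.multinomial_pos _ _).ne'
    exact_mod_cast this
  simp only [eval_eq', Finset.mul_sum]
  rw [Finset.sum_comm]
  refine Finset.sum_eq_zero fun s hs => ?_
  have h5 := key s (by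
    have := hF (mem_support_iff.1 hs)
    rwa [Finsupp.degree_eq_weight_one])
  calc _ = coeff s F * ∑ P ∈ Z, l P * ∏ i, P.rep i ^ s i := by
          rw [Finset.mul_sum]; exact Finset.sum_congr rfl fun P _ => by ring
    _ = 0 := by rw [h5, mul_zero]

lemma indep3 {Z : Finset (Pt 2)} (hl : LGP Z) {P Q R : Pt 2} (hP : P ∈ Z) (hQ : Q ∈ Z) (hR : R ∈ Z)
    (hPQ : P ≠ Q) (hPR : P ≠ R) (hQR : Q ≠ R) :
    LinearIndependent ℂ ![P.rep, Q.rep, R.rep] := by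
  by_contra hcon
  have h1 : (Matrix.of ![P.rep, Q.rep, R.rep]).det = 0 := by
    by_contra hdet
    exact hcon (Matrix.linearIndependent_rows_iff_isUnit.2
      ((Matrix.isUnit_iff_isUnit_det _).2 (isUnit_iff_ne_zero.2 hdet)))
  obtain ⟨v, hv, hM⟩ := Matrix.exists_mulVec_eq_zero_iff.2 h1
  have h2 : ∀ i, eval (![P.rep, Q.rep, R.rep] i) (linForm (m := 2) v) = 0 := by
    intro i
    rw [eval_linForm]
    have := congrFun hM i
    simp only [Matrix.mulVec, dotProduct, Matrix.of_apply, Pi.zero_apply] at this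
    simpa only [mul_comm] using this
  exact hl.off_of (linForm_hom v) (linForm_ne_zero hv) hP hQ hR hPQ hPR hQR (h2 0) (h2 1) (h2 2)

lemma eq_mk {P : Pt 2} {w : Fin 3 → ℂ} (hw : w ≠ 0) (a : ℂ) (h : a • w = P.rep) :
    P = Projectivization.mk ℂ w hw := by
  rw [← P.mk_rep, Projectivization.mk_eq_mk_iff']
  exact ⟨a, h⟩

lemma pair_zero {P Q : Pt 2} (h : P ≠ Q) {a b : ℂ} (h0 : a • P.rep + b • Q.rep = 0) :
    a = 0 ∧ b = 0 := LinearIndependent.pair_iff.1 (indep_pair h) a b h0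

lemma line_inf (t : ℕ) {L : MvPolynomial (Fin 3) ℂ} (hL : L.IsHomogeneous 1) (hL0 : L ≠ 0)
    (A0 : Finset (Pt 2)) (hA0 : ∀ P ∈ A0, eval P.rep L = 0) (u : Pt 2) (hu : eval u.rep L = 0)
    (hu0 : u ∉ A0) (hcard : A0.card = t + 1) (a : Pt 2 → ℂ) (ha : ∀ P ∈ A0, a P ≠ 0) :
    {B : Finset (Pt 2) | B.card ≤ A0.card ∧
      IsDecomp (2 * t) B (∑ P ∈ A0, a P • powRep (2 * t) P)}.Infinite := by
  obtain ⟨v, rfl⟩ := hom_one hL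
  rw [eval_lf] at hu
  replace hA0 : ∀ P ∈ A0, lf v P.rep = 0 := fun P hP => by rw [← eval_lf]; exact hA0 P hP
  obtain ⟨w, hw⟩ : A0.Nonempty := Finset.card_pos.1 (by omega)
  have hwu : w ≠ u := fun h => hu0 (h ▸ hw)
  let φ : Fin 3 → Polynomial ℂ := fun i =>
    Polynomial.C (w.rep i) + Polynomial.C (u.rep i) * Polynomial.X
  have hφ : ∀ s : ℂ, (fun i => (φ i).eval s) = w.rep + s • u.rep := by
    intro s; funext i
    simp only [φ, Polynomial.eval_add, Polynomial.eval_mul, Polynomial.eval_C, Polynomial.eval_X,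
      Pi.add_apply, Pi.smul_apply, smul_eq_mul]
    ring
  have hne : ∀ s : ℂ, (fun i => (φ i).eval s) ≠ 0 := by
    intro s h
    rw [hφ] at h
    exact one_ne_zero (pair_zero hwu (a := 1) (b := s) (by simpa using h)).1
  refine curve_family (2 * t) 1 φ (fun i => ?_) hne ?_ A0 ?_ (by omega) a ha
  · simp only [φ]; compute_degree
  · intro s s' h
    simp only at h
    rw [Projectivization.mk_eq_mk_iff'] at h
    obtain ⟨c, hc⟩ := h
    rw [hφ, hφ] at hc
    obtain ⟨h1, h2⟩ := pair_zero hwu (a := c - 1) (b := c * s' - s) (by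
      have : c • (w.rep + s' • u.rep) - (w.rep + s • u.rep) = 0 := sub_eq_zero.2 hc
      rw [← this]; module)
    have : c = 1 := sub_eq_zero.1 h1
    subst this
    linear_combination -h2
  · intro P hP
    obtain ⟨x, y, hxy⟩ := span_line hL0 hwu (hA0 w hw) hu (hA0 P hP)
    have hx : x ≠ 0 := by
      rintro rfl
      have huP : u ≠ P := fun h => hu0 (h ▸ hP)
      exact rep_smul_ne huP y (by simpa using hxy)
    refine ⟨y / x, eq_mk _ x ?_⟩
    rw [hφ, ← hxy, smul_add, smul_smul, mul_div_cancel₀ _ hx]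

lemma conic_nondeg {Z : Finset (Pt 2)} (hl : LGP Z) {q : MvPolynomial (Fin 3) ℂ}
    (hq : q.IsHomogeneous 2) (hq0 : q ≠ 0) (hZ : ∀ P ∈ Z, eval P.rep q = 0) (hc : 5 ≤ Z.card)
    {b : (Fin 3 → ℂ) →ₗ[ℂ] (Fin 3 → ℂ) →ₗ[ℂ] ℂ} (hs : ∀ x y, b x y = b y x)
    (hb : ∀ x, eval x q = b x x) {P Q : Pt 2} (hP : P ∈ Z) (hQ : Q ∈ Z) (hPQ : P ≠ Q) :
    b P.rep Q.rep ≠ 0 := by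
  intro h0
  obtain ⟨L, hL, hL0, hv⟩ := exists_form 1 {P, Q} (by
      have := Finset.card_le_two (a := P) (b := Q)
      have : (1 + 2).choose 2 = 3 := rfl
      omega)
  have hLP := hv P (by simp)
  have hLQ := hv Q (by simp)
  have hw : P.rep + Q.rep ≠ 0 := by
    intro h
    exact one_ne_zero (pair_zero hPQ (a := 1) (b := 1) (by simpa using h)).1
  obtain ⟨c, hcR⟩ := Projectivization.exists_smul_eq_mk_rep ℂ (P.rep + Q.rep) hw
  set R : Pt 2 := Projectivization.mk ℂ (P.rep + Q.rep) hw with hR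
  rw [Units.smul_def] at hcR
  have hPR : P ≠ R := by
    intro h
    rw [← P.mk_rep, hR, Projectivization.mk_eq_mk_iff'] at h
    obtain ⟨a, ha⟩ := h
    obtain ⟨h1, h2⟩ := pair_zero hPQ (a := a - 1) (b := a) (by
      have := sub_eq_zero.2 ha
      rw [← this]; module)
    rw [h2] at h1; norm_num at h1
  have hQR : Q ≠ R := by
    intro h
    rw [← Q.mk_rep, hR, Projectivization.mk_eq_mk_iff'] at h
    obtain ⟨a, ha⟩ := h
    obtain ⟨h1, h2⟩ := pair_zero hPQ (a := a) (b := a - 1) (by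
      have := sub_eq_zero.2 ha
      rw [← this]; module)
    rw [h1] at h2; norm_num at h2
  have hqP := hZ P hP
  have hqQ := hZ Q hQ
  have hLR : eval R.rep L = 0 := by
    obtain ⟨v, rfl⟩ := hom_one hL
    rw [eval_lf] at *
    rw [← hcR, map_smul, map_add, hLP, hLQ]; simp
  have hqR : eval R.rep q = 0 := by
    rw [hb] at *
    rw [← hcR]
    simp only [map_add, map_smul, LinearMap.add_apply, LinearMap.smul_apply, hqP, hqQ, h0,
      hs Q.rep P.rep]
    simp
  obtain ⟨G, hG, hG0, hGq⟩ := conic_line hq hq0 hL hL0 hPQ hPR hQR hLP hLQ hLR hqP hqQ hqR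
  have c6 := hl L hL hL0
  have c7 := hl G hG hG0
  have c8 : Z ⊆ On Z L ∪ On Z G := by
    intro P hP
    have := hZ P hP
    rw [hGq, mul_eq_zero] at this
    rw [Finset.mem_union, mem_on, mem_on]
    tauto
  have c9 := (Finset.card_le_card c8).trans (Finset.card_union_le _ _)
  omega

lemma conic_inf (d : ℕ) {Z : Finset (Pt 2)} (hl : LGP Z) {q : MvPolynomial (Fin 3) ℂ}
    (hq : q.IsHomogeneous 2) (hq0 : q ≠ 0) (hZ : ∀ P ∈ Z, eval P.rep q = 0) (hc : 5 ≤ Z.card)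
    (A0 : Finset (Pt 2)) (hA0 : A0 ⊆ Z) (hcard : A0.card = d + 1) (hlt : A0.card < Z.card)
    (a : Pt 2 → ℂ) (ha : ∀ P ∈ A0, a P ≠ 0) :
    {B : Finset (Pt 2) | B.card ≤ A0.card ∧
      IsDecomp d B (∑ P ∈ A0, a P • powRep d P)}.Infinite := by
  obtain ⟨p1, hp1, hp1A⟩ := Finset.exists_mem_notMem_of_card_lt_card hlt
  obtain ⟨p0, hp0, p2, hp2, h02⟩ := Finset.one_lt_card.1 (show 1 < (Z.erase p1).card by
    rw [Finset.card_erase_of_mem hp1]; omega)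
  rw [Finset.mem_erase] at hp0 hp2
  obtain ⟨h01, hp0⟩ := hp0
  obtain ⟨h21, hp2⟩ := hp2
  obtain ⟨b, hs, hb⟩ := hom_two hq
  have hα := conic_nondeg hl hq hq0 hZ hc hs hb hp1 hp2 h21.symm
  have hβ := conic_nondeg hl hq hq0 hZ hc hs hb hp0 hp2 h02
  have hγ := conic_nondeg hl hq hq0 hZ hc hs hb hp0 hp1 h01
  have e0 := hZ p0 hp0
  have e1 := hZ p1 hp1
  have e2 := hZ p2 hp2
  rw [hb] at e0 e1 e2
  have hqq : ∀ x y z : ℂ, eval (x • p0.rep + y • p1.rep + z • p2.rep) q =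
      2 * (b p0.rep p1.rep * x * y + b p0.rep p2.rep * x * z + b p1.rep p2.rep * y * z) := by
    intro x y z
    rw [hb]
    simp only [map_add, map_smul, LinearMap.add_apply, LinearMap.smul_apply, smul_eq_mul, e0, e1, e2,
      hs p1.rep p0.rep, hs p2.rep p0.rep, hs p2.rep p1.rep]
    ring
  set α := b p1.rep p2.rep
  set β := b p0.rep p2.rep
  set γ := b p0.rep p1.rep
  have hind := indep3 hl hp0 hp1 hp2 h01 h02 h21.symm
  have hz : ∀ x y z : ℂ, x • p0.rep + y • p1.rep + z • p2.rep = 0 → x = 0 ∧ y = 0 ∧ z = 0 := by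
    intro x y z h
    have := Fintype.linearIndependent_iff.1 hind ![x, y, z] (by
      simpa [Fin.sum_univ_three] using h)
    exact ⟨this 0, this 1, this 2⟩
  have hspan : ∀ P : Fin 3 → ℂ, ∃ x y z : ℂ, x • p0.rep + y • p1.rep + z • p2.rep = P := by
    intro P
    have h1 := hind.span_eq_top_of_card_eq_finrank (by simp)
    have h2 : P ∈ Submodule.span ℂ (Set.range ![p0.rep, p1.rep, p2.rep]) := by rw [h1]; trivial
    obtain ⟨c, hc⟩ := (Submodule.mem_span_range_iff_exists_fun ℂ).1 h2
    refine ⟨c 0, c 1, c 2, ?_⟩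
    rw [← hc]
    simp [Fin.sum_univ_three]
  let φ : Fin 3 → Polynomial ℂ := fun i =>
    - (Polynomial.C (α * p0.rep i) * (1 + Polynomial.X))
    - Polynomial.C (β * p1.rep i) * (Polynomial.X + Polynomial.X ^ 2)
    + Polynomial.C (γ * p2.rep i) * Polynomial.X
  have hφ : ∀ s : ℂ, (fun i => (φ i).eval s) =
      (-α * (1 + s)) • p0.rep + (-β * (s * (1 + s))) • p1.rep + (γ * s) • p2.rep := by
    intro s; funext i; simp [φ]; ring
  have hne : ∀ s : ℂ, (fun i => (φ i).eval s) ≠ 0 := by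
    intro s h
    rw [hφ] at h
    obtain ⟨h1, _, h3⟩ := hz _ _ _ h
    have h4 : 1 + s = 0 := by simpa [hα] using h1
    have h5 : s = 0 := by simpa [hγ] using h3
    rw [h5] at h4; norm_num at h4
  refine curve_family d 2 φ (fun i => ?_) hne ?_ A0 ?_ (by omega) a ha
  · simp only [φ]; compute_degree
  · intro s s' h
    simp only at h
    rw [Projectivization.mk_eq_mk_iff'] at h
    obtain ⟨c, hc⟩ := h
    rw [hφ, hφ] at hc
    obtain ⟨h1, h2, h3⟩ := hz (-α * (c * (1 + s') - (1 + s)))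
        (-β * (c * (s' * (1 + s')) - s * (1 + s))) (γ * (c * s' - s)) (by
      rw [← sub_eq_zero.2 hc]; module)
    have h4 : c * (1 + s') - (1 + s) = 0 := by simpa [hα] using h1
    have h5 : c * s' - s = 0 := by simpa [hγ] using h3
    have : c = 1 := by linear_combination h4 - h5
    subst this
    linear_combination -h5
  · intro P hP
    obtain ⟨x, y, z, hxyz⟩ := hspan P.rep
    have hP1 : p1 ≠ P := fun h => hp1A (h ▸ hP)
    have hqP := hZ P (hA0 hP)
    rw [← hxyz, hqq] at hqP
    by_cases hx : x = 0
    · subst hx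
      have hyz : y * z = 0 := by simpa [hα] using hqP
      have hz0 : z ≠ 0 := by
        rintro rfl
        exact rep_smul_ne hP1 y (by simpa using hxyz)
      have hy : y = 0 := (mul_eq_zero.1 hyz).resolve_right hz0
      subst hy
      refine ⟨-1, eq_mk _ (-z / γ) ?_⟩
      rw [hφ, ← hxyz]
      have : -z / γ * (γ * -1) = z := by field_simp
      rw [smul_add, smul_add, smul_smul, smul_smul, smul_smul, this]
      simp
    · set s := α * y / (β * x) with hsdef
      have hsx : β * x * s = α * y := by rw [hsdef]; field_simp
      have hrel : z * (β * x) * (1 + s) = - (γ * x * y) := by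
        linear_combination hqP / 2 + z * hsx
      have h1s : 1 + s ≠ 0 := by
        intro h
        rw [h, mul_zero] at hrel
        have : y = 0 := by
          have h' : γ * x * y = 0 := by linear_combination hrel
          simpa [hγ, hx] using h'
        rw [this] at hsx
        have : s = 0 := by simpa [hβ, hx] using hsx
        rw [this] at h; norm_num at h
      refine ⟨s, eq_mk _ (- x / (α * (1 + s))) ?_⟩
      rw [hφ, ← hxyz, smul_add, smul_add, smul_smul, smul_smul, smul_smul]
      have t1 : - x / (α * (1 + s)) * (-α * (1 + s)) = x := by field_simp
      have t2 : - x / (α * (1 + s)) * (-β * (s * (1 + s))) = y := by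
        field_simp
        linear_combination hsx
      have t3 : - x / (α * (1 + s)) * (γ * s) = z := by
        field_simp
        have : β * x * (- (x * γ * s)) = β * x * (z * α * (1 + s)) := by
          linear_combination -x * γ * hsx - α * hrel
        have := mul_left_cancel₀ (mul_ne_zero hβ hx) this
        linear_combination this
      rw [t1, t2, t3]

instance infinite_Pt : Infinite (Pt 2) := by
  have hne : ∀ s : ℂ, (![1, s, 0] : Fin 3 → ℂ) ≠ 0 := fun s h => by
    have := congrFun h 0
    simp at this
  refine Infinite.of_injective (fun s : ℂ => (Projectivization.mk ℂ _ (hne s) : Pt 2)) ?_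
  intro s s' h
  simp only at h
  rw [Projectivization.mk_eq_mk_iff'] at h
  obtain ⟨c, hc⟩ := h
  have h0 : c = 1 := by simpa using congrFun hc 0
  have h1 := congrFun hc 1
  subst h0
  simpa using h1.symm

lemma small_inf {d N : ℕ} {B : Finset (Pt 2)} {T : MvPolynomial (Fin 3) ℂ} (h : IsDecomp d B T)
    (hN : B.card < N) : {C : Finset (Pt 2) | IsDecomp d C T ∧ C.card ≤ N}.Infinite := by
  have h1 : {Q : Pt 2 | Q ∉ B}.Infinite := B.finite_toSet.infinite_compl
  refine Set.infinite_of_injOn_mapsTo (f := fun Q => insert Q B) ?_ ?_ h1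
  · intro Q hQ Q' hQ' hQQ
    have : Q ∈ insert Q' B := by
      have h2 : insert Q B = insert Q' B := hQQ
      rw [← h2]; exact Finset.mem_insert_self _ _
    exact (Finset.mem_insert.1 this).resolve_right hQ
  · intro Q _
    exact ⟨h.mono (Finset.subset_insert _ _), (Finset.card_insert_le _ _).trans hN⟩

lemma pick {W A B : Finset (Pt 2)} (k : ℕ) (h : W ⊆ A ∪ B) (hk : 2 * k ≤ W.card + 1) :
    (∃ A0 ⊆ A, A0 ⊆ W ∧ A0.card = k) ∨ (∃ A0 ⊆ B, A0 ⊆ W ∧ A0.card = k) := by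
  have h1 : W.card ≤ (A ∩ W).card + (B ∩ W).card := by
    refine (Finset.card_le_card ?_).trans (Finset.card_union_le _ _)
    intro P hP
    rw [Finset.mem_union, Finset.mem_inter, Finset.mem_inter]
    have := Finset.mem_union.1 (h hP)
    tauto
  by_cases h2 : k ≤ (A ∩ W).card
  · obtain ⟨s, hs, hsk⟩ := Finset.exists_subset_card_eq h2
    exact Or.inl ⟨s, hs.trans Finset.inter_subset_left, hs.trans Finset.inter_subset_right, hsk⟩
  · obtain ⟨s, hs, hsk⟩ := Finset.exists_subset_card_eq (show k ≤ (B ∩ W).card by omega)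
    exact Or.inr ⟨s, hs.trans Finset.inter_subset_left, hs.trans Finset.inter_subset_right, hsk⟩

lemma main_inf {t N : ℕ} (ht : 1 ≤ t) {Z A B : Finset (Pt 2)} (hrel : IsRel (2 * t) Z)
    (hne : Z.Nonempty)
    (hc : Z.card + 1 ≤ 3 * (2 * t)) (hAB : Z ⊆ A ∪ B) {T : MvPolynomial (Fin 3) ℂ}
    {a b : Pt 2 → ℂ} (hTa : T = ∑ P ∈ A, a P • powRep (2 * t) P)
    (hTb : T = ∑ P ∈ B, b P • powRep (2 * t) P) (ha : ∀ P ∈ A, a P ≠ 0) (hb : ∀ P ∈ B, b P ≠ 0)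
    (hA : A.card = N) (hB : B.card = N) :
    {C : Finset (Pt 2) | IsDecomp (2 * t) C T ∧ C.card ≤ N}.Infinite := by
  have hline : ∀ L : MvPolynomial (Fin 3) ℂ, L.IsHomogeneous 1 → L ≠ 0 →
      2 * t + 1 ≤ (On Z L).card →
      {C : Finset (Pt 2) | IsDecomp (2 * t) C T ∧ C.card ≤ N}.Infinite := by
    intro L hL hL0 hW
    rcases pick (t + 1) ((on_sub Z L).trans hAB) (by omega) with
      ⟨A0, h1, h2, h3⟩ | ⟨A0, h1, h2, h3⟩
    · obtain ⟨u, hu, hu0⟩ := Finset.exists_mem_notMem_of_card_lt_card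
        (show A0.card < (On Z L).card by omega)
      rw [← hA]
      exact extend_inf a hTa h1 (line_inf t hL hL0 A0 (fun P hP => (mem_on.1 (h2 hP)).2) u
        (mem_on.1 hu).2 hu0 h3 a fun P hP => ha P (h1 hP))
    · obtain ⟨u, hu, hu0⟩ := Finset.exists_mem_notMem_of_card_lt_card
        (show A0.card < (On Z L).card by omega)
      rw [← hB]
      exact extend_inf b hTb h1 (line_inf t hL hL0 A0 (fun P hP => (mem_on.1 (h2 hP)).2) u
        (mem_on.1 hu).2 hu0 h3 b fun P hP => hb P (h1 hP))
  rcases structure_thm _ Z hrel hc with ⟨L, M, hL, hL0, hM, hM0, hcov⟩ | ⟨hl, q, hq, hq0, hv⟩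
  · by_cases ho : (Off Z L).Nonempty
    · refine hline M hM hM0 ?_
      have h1 := rel_card (2 * t - 1) (Off Z L) (IsRel.resid (m := 1) (by
        rwa [show 2 * t - 1 + 1 = 2 * t by omega]) hL) ho
      have h2 : (Off Z L).card ≤ (On Z M).card := Finset.card_le_card fun P hP => by
        rw [mem_off] at hP
        exact mem_on.2 ⟨hP.1, (hcov P hP.1).resolve_left hP.2⟩
      omega
    · refine hline L hL hL0 ?_
      have h1 := rel_card _ _ hrel hne
      have h2 := card_le_on (Finset.Subset.refl Z) (off_empty ho)
      omega
  · have c1 := rel_card_lgp _ _ hrel hl hne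
    rcases pick (2 * t + 1) hAB (by omega) with ⟨A0, h1, h2, h3⟩ | ⟨A0, h1, h2, h3⟩
    · rw [← hA]
      exact extend_inf a hTa h1 (conic_inf _ hl hq hq0 hv (by omega) A0 h2 h3 (by omega) a
        fun P hP => ha P (h1 hP))
    · rw [← hB]
      exact extend_inf b hTb h1 (conic_inf _ hl hq hq0 hv (by omega) A0 h2 h3 (by omega) b
        fun P hP => hb P (h1 hP))

lemma erase_decomp {d : ℕ} {A : Finset (Pt 2)} {T : MvPolynomial (Fin 3) ℂ} {a : Pt 2 → ℂ}
    (hT : T = ∑ P ∈ A, a P • powRep d P) {P : Pt 2} (hP : P ∈ A) (h0 : a P = 0) :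
    IsDecomp d (A.erase P) T := by
  refine ⟨a, ?_⟩
  rw [hT, ← Finset.add_sum_erase _ _ hP, h0, zero_smul, zero_add]

lemma final_aux (n : ℕ) (T : MvPolynomial (Fin 3) ℂ) (A B : Finset (Pt 2))
    (hA : IsDecomp (8 + 2 * n) A T) (hB : IsDecomp (8 + 2 * n) B T)
    (hr : A.card ≤ 11 + 3 * n) (hBA : B.card ≤ A.card) (hne : B ≠ A) :
    {B : Finset (Pt 2) | IsDecomp (8 + 2 * n) B T ∧ B.card ≤ 11 + 3 * n}.Infinite := by
  by_cases hBs : B.card < 11 + 3 * n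
  · exact small_inf hB hBs
  have hBc : B.card = 11 + 3 * n := by omega
  have hAc : A.card = 11 + 3 * n := by omega
  obtain ⟨a, ha⟩ := id hA
  obtain ⟨b, hb⟩ := id hB
  by_cases ha0 : ∃ P ∈ A, a P = 0
  · obtain ⟨P, hP, h0⟩ := ha0
    refine small_inf (erase_decomp ha hP h0) ?_
    rw [Finset.card_erase_of_mem hP]; omega
  by_cases hb0 : ∃ P ∈ B, b P = 0
  · obtain ⟨P, hP, h0⟩ := hb0
    refine small_inf (erase_decomp hb hP h0) ?_
    rw [Finset.card_erase_of_mem hP]; omega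
  push Not at ha0 hb0
  rw [show 8 + 2 * n = 2 * (4 + n) by ring] at *
  let l : Pt 2 → ℂ := fun P => (if P ∈ A then a P else 0) - (if P ∈ B then b P else 0)
  have hsum : ∑ P ∈ A ∪ B, l P • powRep (2 * (4 + n)) P = 0 := by
    simp only [l, sub_smul, Finset.sum_sub_distrib, ite_smul, zero_smul]
    rw [← Finset.sum_filter, ← Finset.sum_filter]
    rw [show (A ∪ B).filter (· ∈ A) = A by ext; simp,
      show (A ∪ B).filter (· ∈ B) = B by ext; simp, ← ha, ← hb, sub_self]
  let Z := (A ∪ B).filter fun P => l P ≠ 0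
  have hrel : IsRel (2 * (4 + n)) Z := by
    refine ⟨l, fun P hP => (Finset.mem_filter.1 hP).2, fun F hF => apolar ?_ hF⟩
    rw [← hsum, Finset.sum_filter]
    refine Finset.sum_congr rfl fun P _ => ?_
    split_ifs with h
    · rfl
    · push Not at h; rw [h, zero_smul]
  have hZne : Z.Nonempty := by
    obtain ⟨P, hP, hPB⟩ : ∃ P ∈ A, P ∉ B := by
      by_contra! hcon
      exact hne (Finset.eq_of_subset_of_card_le hcon (by omega)).symm
    refine ⟨P, Finset.mem_filter.2 ⟨Finset.mem_union_left _ hP, ?_⟩⟩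
    simp only [l, if_pos hP, if_neg hPB, sub_zero]
    exact ha0 P hP
  have hZc : Z.card + 1 ≤ 3 * (2 * (4 + n)) := by
    have h1 : Z.card ≤ (A ∪ B).card := Finset.card_le_card (Finset.filter_subset _ _)
    have h2 := Finset.card_union_le A B
    omega
  exact main_inf (by omega) hrel hZne hZc (Finset.filter_subset _ _) ha hb ha0 hb0 hAc hBc

/-- For a ternary form `T` of degree `d = 8+2n` with a non-redundant
decomposition `A` of length `r ≤ 11+3n`, either `A` is the unique decomposition of `T`
of length at most `r`, or `T` admits infinitely many decompositions of length at most
`11+3n`. -/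
theorem stmt0 (n : ℕ) (T : MvPolynomial (Fin 3) ℂ) (hT0 : T ≠ 0)
    (hThom : T.IsHomogeneous (8 + 2 * n))
    (A : Finset (Pt 2)) (hA : IsDecomp (8 + 2 * n) A T)
    (hAnr : NonRedundant (8 + 2 * n) A T)
    (hr : A.card ≤ 11 + 3 * n) :
    (∀ B : Finset (Pt 2), IsDecomp (8 + 2 * n) B T → B.card ≤ A.card → B = A) ∨
      {B : Finset (Pt 2) | IsDecomp (8 + 2 * n) B T ∧ B.card ≤ 11 + 3 * n}.Infinite := by
  by_cases h : ∀ B : Finset (Pt 2), IsDecomp (8 + 2 * n) B T → B.card ≤ A.card → B = A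
  · exact Or.inl h
  · push Not at h
    obtain ⟨B, hB, hBA, hne⟩ := h
    exact Or.inr (final_aux n T A B hA hB hr hBA hne)

end
end

section
/- Fix n ∈ ℕ and set d = 2n+8. Let A = {P_1,…,P_r} ⊂ ℙ^2 be a non-redundant decomposition of a ternary form T of degree d with r = ℓ(A) ≤ 3n+11, and let L_1,…,L_r be linear forms representing P_1,…,P_r. If the Terracini space τ of A has vector-space dimension 3r — equivalently, if the 3r degree-d forms x_j·L_i^{d−1} (j = 0,1,2; i = 1,…,r) are linearly independent — then A is minimal, T has rank r, and T is identifiable (A is the unique decomposition of T of length at most r). -/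
open MvPolynomial
open scoped Classical

noncomputable section

abbrev Hm (e : ℕ) := homogeneousSubmodule (Fin 3) ℂ e

def ev (P : Pt 2) : MvPolynomial (Fin 3) ℂ →+* ℂ := eval (P.rep : Fin 3 → ℂ)

instance hmFin (e : ℕ) : FiniteDimensional ℂ (Hm e) :=
  Module.Finite.iff_fg.mpr (homogeneousSubmodule_fg _ _ e)

lemma hm_finrank (e : ℕ) : 2 * Module.finrank ℂ (Hm e) = (e + 1) * (e + 2) := by
  have h1 : Module.finrank ℂ (Hm e) = Nat.card {d : Fin 3 →₀ ℕ | d.degree = e} := by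
    have := Module.finrank_eq_nat_card_basis
      (basisRestrictSupport ℂ {d : Fin 3 →₀ ℕ | d.degree = e})
    rw [← this]
    have h2 := homogeneousSubmodule_eq_finsupp_supported (Fin 3) ℂ e
    unfold Hm
    rw [h2]
    rfl
  have h3 : {d : Fin 3 →₀ ℕ | d.degree = e} = ((Finset.univ : Finset (Fin 3)).finsuppAntidiag e : Set _) := by
    ext d
    simp [Finset.mem_finsuppAntidiag, Finsupp.degree_eq_sum]
  rw [h1, h3]
  simp only [Nat.card_eq_fintype_card, Fintype.card_coe, Finset.coe_sort_coe]
  rw [Finset.card_finsuppAntidiag_nat_eq_choose]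
  simp only [Finset.card_univ, Fintype.card_fin]
  have : 3 + e - 1 = e + 2 := by omega
  rw [this, Nat.choose_symm_add, Nat.choose_two_right]
  have h4 : (e + 2) * (e + 2 - 1) = (e+1) * (e+2) := by
    have : e + 2 - 1 = e + 1 := by omega
    rw [this]; ring
  rw [h4]
  exact Nat.mul_div_cancel' (Nat.even_mul_succ_self (e+1)).two_dvd

def evS (S : Finset (Pt 2)) (e : ℕ) : Hm e →ₗ[ℂ] (S → ℂ) where
  toFun F P := ev P.1 F.1
  map_add' F G := by funext P; simp
  map_smul' c F := by funext P; simp [ev, smul_eq_C_mul]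

lemma exists_through (S : Finset (Pt 2)) (e : ℕ) (h : 2 * S.card < (e + 1) * (e + 2)) :
    ∃ F : MvPolynomial (Fin 3) ℂ, F.IsHomogeneous e ∧ F ≠ 0 ∧ ∀ P ∈ S, ev P F = 0 := by
  have h1 : Module.finrank ℂ (S → ℂ) < Module.finrank ℂ (Hm e) := by
    have := hm_finrank e
    simp only [Module.finrank_fintype_fun_eq_card, Fintype.card_coe]
    omega
  obtain ⟨x, hx, hx0⟩ := Submodule.exists_mem_ne_zero_of_ne_bot
    (LinearMap.ker_ne_bot_of_finrank_lt (f := evS S e) h1)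
  refine ⟨x.1, x.2, fun h => hx0 (Subtype.ext h), fun P hP => ?_⟩
  exact congrFun (LinearMap.mem_ker.mp hx) ⟨P, hP⟩

lemma hc_mul_s1 {F : MvPolynomial (Fin 3) ℂ} {m : ℕ} (hF : F.IsHomogeneous m)
    (G : MvPolynomial (Fin 3) ℂ) (k : ℕ) :
    homogeneousComponent (m + k) (F * G) = F * homogeneousComponent k G := by
  conv_lhs => rw [← sum_homogeneousComponent G, Finset.mul_sum, map_sum]
  have h1 : ∀ i, homogeneousComponent (m + k) (F * homogeneousComponent i G) =
      if i = k then F * homogeneousComponent k G else 0 := by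
    intro i
    rw [homogeneousComponent_of_mem (hF.mul (homogeneousComponent_isHomogeneous i G))]
    by_cases h : i = k
    · subst h; simp
    · rw [if_neg h, if_neg]; omega
  simp_rw [h1]
  rw [Finset.sum_ite_eq']
  split_ifs with h
  · rfl
  · rw [homogeneousComponent_eq_zero, mul_zero]
    simpa using h

lemma hc_top (a b : MvPolynomial (Fin 3) ℂ) :
    homogeneousComponent (a.totalDegree + b.totalDegree) (a * b) =
      homogeneousComponent a.totalDegree a * homogeneousComponent b.totalDegree b := by
  have e : a * b = (∑ i ∈ Finset.range (a.totalDegree + 1), homogeneousComponent i a) * b := by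
    rw [sum_homogeneousComponent]
  rw [e, Finset.sum_range_succ, add_mul, map_add, hc_mul_s1 (homogeneousComponent_isHomogeneous _ _)]
  convert zero_add _
  rw [Finset.sum_mul, map_sum]
  apply Finset.sum_eq_zero
  intro i hi
  apply homogeneousComponent_eq_zero
  refine lt_of_le_of_lt (totalDegree_mul _ _) ?_
  have := (homogeneousComponent_isHomogeneous i a).totalDegree_le
  simp at hi
  omega

/-- quotient of homogeneous polys -/
lemma hom_quot {F B : MvPolynomial (Fin 3) ℂ} {m k : ℕ} (hF : F.IsHomogeneous m)
    (hB : B.IsHomogeneous (m + k)) (h : F ∣ B) :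
    ∃ G : MvPolynomial (Fin 3) ℂ, G.IsHomogeneous k ∧ B = F * G := by
  obtain ⟨G, rfl⟩ := h
  refine ⟨_, homogeneousComponent_isHomogeneous k G, ?_⟩
  rw [← hc_mul_s1 hF, homogeneousComponent_eq_self hB]

/-- reducible cubics -/
lemma cubic_red {F : MvPolynomial (Fin 3) ℂ} (hF : F.IsHomogeneous 3) (h0 : F ≠ 0)
    (hi : ¬ Irreducible F) :
    ∃ l q : MvPolynomial (Fin 3) ℂ, l.IsHomogeneous 1 ∧ q.IsHomogeneous 2 ∧ F = l * q := by
  have hd := hF.totalDegree h0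
  have hu : ∀ a : MvPolynomial (Fin 3) ℂ, a ≠ 0 → ¬ IsUnit a → a.totalDegree ≠ 0 := by
    intro a ha hua h
    rw [totalDegree_eq_zero_iff_eq_C] at h
    apply hua
    rw [h]
    apply IsUnit.map
    rw [isUnit_iff_ne_zero]
    intro h1
    rw [h1] at h
    exact ha (by simpa using h)
  have hnu : ¬ IsUnit F := by
    intro hu
    obtain ⟨c, hc, hc'⟩ := MvPolynomial.isUnit_iff_eq_C_of_isReduced.mp hu
    rw [hc'] at hd
    simp at hd
  rw [irreducible_iff] at hi
  push Not at hi
  obtain ⟨a, b, hab, ha, hb⟩ := hi hnu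
  have ha0 : a ≠ 0 := by rintro rfl; simp at hab; exact h0 hab
  have hb0 : b ≠ 0 := by rintro rfl; simp at hab; exact h0 hab
  have hsum : a.totalDegree + b.totalDegree = 3 := by
    rw [← totalDegree_mul_of_isDomain ha0 hb0, ← hab, hd]
  have h1 := hu a ha0 ha
  have h2 := hu b hb0 hb
  have h3 := hc_top a b
  rw [hsum, ← hab, homogeneousComponent_eq_self hF] at h3
  have ka := homogeneousComponent_isHomogeneous a.totalDegree a
  have kb := homogeneousComponent_isHomogeneous b.totalDegree b
  rcases (by omega : a.totalDegree = 1 ∧ b.totalDegree = 2 ∨ a.totalDegree = 2 ∧ b.totalDegree = 1) with ⟨e1, e2⟩ | ⟨e1, e2⟩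
  · rw [e1, e2] at h3
    rw [e1] at ka
    rw [e2] at kb
    exact ⟨_, _, ka, kb, h3⟩
  · rw [e1, e2] at h3
    rw [e1] at ka
    rw [e2] at kb
    exact ⟨_, _, kb, ka, by rw [h3, mul_comm]⟩

lemma exists_lin (P : Pt 2) : ∃ F : MvPolynomial (Fin 3) ℂ, F.IsHomogeneous 1 ∧ ev P F ≠ 0 := by
  have := P.rep_nonzero
  obtain ⟨i, hi⟩ := Function.ne_iff.mp this
  refine ⟨X i, isHomogeneous_X _ _, ?_⟩
  simpa [ev] using hi

lemma exists_sep_lin {P Q : Pt 2} (h : P ≠ Q) :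
    ∃ F : MvPolynomial (Fin 3) ℂ, F.IsHomogeneous 1 ∧ ev P F ≠ 0 ∧ ev Q F = 0 := by
  by_contra hcon
  push Not at hcon
  apply h
  have hc : ∀ i j : Fin 3, P.rep i * Q.rep j = P.rep j * Q.rep i := by
    intro i j
    by_contra hne
    have := hcon (C (Q.rep j) * X i - C (Q.rep i) * X j)
      ((isHomogeneous_C_mul_X _ _).sub (isHomogeneous_C_mul_X _ _))
    apply this
    · simp only [ev, map_sub, map_mul, eval_C, eval_X]
      intro h
      apply hne
      linear_combination h
    · simp only [ev, map_sub, map_mul, eval_C, eval_X]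
      ring
  obtain ⟨j, hj⟩ := Function.ne_iff.mp Q.rep_nonzero
  obtain ⟨i, hi⟩ := Function.ne_iff.mp P.rep_nonzero
  simp only [Pi.zero_apply] at hi hj
  have hjP : P.rep j ≠ 0 := by
    intro h0
    have := hc i j
    rw [h0] at this
    simp [hi, hj] at this
  rw [← P.mk_rep, ← Q.mk_rep, Projectivization.mk_eq_mk_iff']
  refine ⟨P.rep j / Q.rep j, ?_⟩
  funext k
  simp only [Pi.smul_apply, smul_eq_mul]
  field_simp
  linear_combination (hc j k)

lemma exists_sep_s1 (t : ℕ) (S : Finset (Pt 2)) (P : Pt 2) (hP : P ∉ S) (h : S.card ≤ t) :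
    ∃ F : MvPolynomial (Fin 3) ℂ, F.IsHomogeneous t ∧ ev P F ≠ 0 ∧ ∀ Q ∈ S, ev Q F = 0 := by
  induction S using Finset.induction_on generalizing t with
  | empty =>
    obtain ⟨F, hF, hF0⟩ := exists_lin P
    refine ⟨F ^ t, by simpa using hF.pow t, ?_, by simp⟩
    rw [map_pow]; exact pow_ne_zero _ hF0
  | insert Q S hQ ih =>
    rw [Finset.card_insert_of_notMem hQ] at h
    simp only [Finset.mem_insert, not_or] at hP
    obtain ⟨s, rfl⟩ : ∃ s, t = s + 1 := ⟨t - 1, by omega⟩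
    obtain ⟨F, hF, h1, h2⟩ := ih s hP.2 (by omega)
    obtain ⟨G, hG, h3, h4⟩ := exists_sep_lin hP.1
    refine ⟨F * G, hF.mul hG, by simp [h1, h3], ?_⟩
    intro R hR
    rcases Finset.mem_insert.mp hR with rfl | hR
    · simp [h4]
    · simp [h2 R hR]

lemma evS_surj (S : Finset (Pt 2)) (t : ℕ) (h : S.card ≤ t) : Function.Surjective (evS S t) := by
  have hex : ∀ P : S, ∃ F : MvPolynomial (Fin 3) ℂ, F.IsHomogeneous t ∧ ev P F ≠ 0 ∧
      ∀ Q ∈ S.erase P, ev Q F = 0 := fun P =>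
    exists_sep_s1 t (S.erase P) P (by simp) (le_trans (Finset.card_le_card (Finset.erase_subset _ _)) h)
  choose F hF h1 h2 using hex
  intro y
  refine ⟨∑ P : S, (y P / ev P (F P)) • (⟨F P, hF P⟩ : Hm t), ?_⟩
  rw [map_sum]
  funext Q
  rw [Finset.sum_apply, Finset.sum_eq_single Q]
  · simp only [map_smul, Pi.smul_apply, smul_eq_mul, evS, LinearMap.coe_mk, AddHom.coe_mk]
    field_simp [h1 Q]
  · intro P _ hPQ
    have := h2 P Q.1 (by simp [Subtype.coe_injective.ne_iff, hPQ.symm])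
    simp only [map_smul, Pi.smul_apply, smul_eq_mul, evS, LinearMap.coe_mk, AddHom.coe_mk]
    rw [this]; simp
  · simp



/-- multiplication by `F` as a linear map on degree `k` forms -/
def mulL (F : MvPolynomial (Fin 3) ℂ) (k : ℕ) : Hm k →ₗ[ℂ] MvPolynomial (Fin 3) ℂ :=
  (LinearMap.mulLeft ℂ F).comp (Hm k).subtype

lemma mulL_apply (F : MvPolynomial (Fin 3) ℂ) (k : ℕ) (x : Hm k) : mulL F k x = F * x.1 := rfl

lemma mulL_finrank {F : MvPolynomial (Fin 3) ℂ} (h : F ≠ 0) (k : ℕ) :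
    Module.finrank ℂ (LinearMap.range (mulL F k)) = Module.finrank ℂ (Hm k) := by
  apply LinearMap.finrank_range_of_inj
  intro x y hxy
  rw [mulL_apply, mulL_apply] at hxy
  exact Subtype.ext (mul_left_cancel₀ h hxy)

/-- forms of degree `e` vanishing on `S` -/
def van (S : Finset (Pt 2)) (e : ℕ) : Submodule ℂ (MvPolynomial (Fin 3) ℂ) :=
  (LinearMap.ker (evS S e)).map (Hm e).subtype

instance vanFin (S : Finset (Pt 2)) (e : ℕ) : FiniteDimensional ℂ (van S e) := by
  unfold van; infer_instance

lemma mem_van {S : Finset (Pt 2)} {e : ℕ} {F : MvPolynomial (Fin 3) ℂ} :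
    F ∈ van S e ↔ F.IsHomogeneous e ∧ ∀ P ∈ S, ev P F = 0 := by
  unfold van
  rw [Submodule.mem_map]
  constructor
  · rintro ⟨x, hx, rfl⟩
    exact ⟨x.2, fun P hP => congrFun (LinearMap.mem_ker.mp hx) ⟨P, hP⟩⟩
  · rintro ⟨h1, h2⟩
    exact ⟨⟨F, h1⟩, LinearMap.mem_ker.mpr (funext fun P => h2 P.1 P.2), rfl⟩

lemma van_finrank (S : Finset (Pt 2)) (e : ℕ) :
    Module.finrank ℂ (LinearMap.range (evS S e)) + Module.finrank ℂ (van S e) =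
      Module.finrank ℂ (Hm e) := by
  unfold van
  rw [Submodule.finrank_map_subtype_eq]
  exact LinearMap.finrank_range_add_finrank_ker (evS S e)

lemma bezout_s1 {F G : MvPolynomial (Fin 3) ℂ} {j : ℕ} (hF : F.IsHomogeneous 3)
    (hG : G.IsHomogeneous j) (hirr : Irreducible F) (hnd : ¬ F ∣ G) (S : Finset (Pt 2))
    (h1 : ∀ P ∈ S, ev P F = 0) (h2 : ∀ P ∈ S, ev P G = 0) : S.card ≤ 3 * j := by
  set s := S.card with hs
  let φ : (Hm (s + j) × Hm (s + 3)) →ₗ[ℂ] MvPolynomial (Fin 3) ℂ :=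
    LinearMap.coprod (mulL F (s + j)) (mulL G (s + 3))
  let ψ : Hm s →ₗ[ℂ] (Hm (s + j) × Hm (s + 3)) :=
    { toFun := fun C => (⟨-(G * C.1), by
          have := (hG.mul C.2).neg; rwa [add_comm] at this⟩, ⟨F * C.1, by
          have := hF.mul C.2; rwa [add_comm] at this⟩)
      map_add' := fun x y => by
        ext1 <;> apply Subtype.ext <;> simp <;> ring
      map_smul' := fun c x => by
        ext1 <;> apply Subtype.ext <;> simp }
  have hker : LinearMap.ker φ ≤ LinearMap.range ψ := by
    rintro ⟨A, B⟩ hAB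
    have e1 : F * A.1 + G * B.1 = 0 := by
      simpa [φ, mulL_apply] using hAB
    have hdvd : F ∣ G * B.1 := ⟨-A.1, by linear_combination e1⟩
    have hB : F ∣ B.1 := (hirr.prime.dvd_or_dvd hdvd).resolve_left hnd
    obtain ⟨D, hD, hBD⟩ := hom_quot (k := s) hF (add_comm s 3 ▸ (mem_homogeneousSubmodule _ _).mp B.2 : IsHomogeneous B.1 (3 + s)) hB
    refine ⟨⟨D, hD⟩, ?_⟩
    ext1
    · apply Subtype.ext
      change -(G * D) = A.1
      apply mul_left_cancel₀ hirr.ne_zero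
      rw [hBD] at e1
      linear_combination -e1
    · apply Subtype.ext
      exact hBD.symm
  have hrange : LinearMap.range φ ≤ van S (s + 3 + j) := by
    rintro _ ⟨⟨A, B⟩, rfl⟩
    rw [mem_van]
    simp only [φ, LinearMap.coprod_apply, mulL_apply]
    refine ⟨IsHomogeneous.add ?_ ?_, ?_⟩
    · have := hF.mul A.2
      convert this using 1; omega
    · have := hG.mul B.2
      convert this using 1; omega
    · intro P hP
      simp [h1 P hP, h2 P hP]
  have k1 := Submodule.finrank_mono hker
  have k2 := LinearMap.finrank_range_le ψ
  have k3 := Submodule.finrank_mono hrange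
  have k4 := LinearMap.finrank_range_add_finrank_ker φ
  have k5 := van_finrank S (s + 3 + j)
  have k6 : Module.finrank ℂ (LinearMap.range (evS S (s + 3 + j))) = s := by
    rw [LinearMap.range_eq_top.mpr (evS_surj S _ (by omega))]
    simp [hs]
  rw [Module.finrank_prod] at k4
  have d1 := hm_finrank s
  have d2 := hm_finrank (s + j)
  have d3 := hm_finrank (s + 3)
  have d4 := hm_finrank (s + 3 + j)
  nlinarith

lemma hf_ge {F : MvPolynomial (Fin 3) ℂ} {j : ℕ} (hF : F.IsHomogeneous 3)
    (hirr : Irreducible F) (S : Finset (Pt 2)) (h1 : ∀ P ∈ S, ev P F = 0) (hj : 3 * j < S.card) 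
    (hj1 : 1 ≤ j) :
    3 * j ≤ Module.finrank ℂ (LinearMap.range (evS S j)) := by
  have hd : ∀ G ∈ van S j, F ∣ G := by
    intro G hG
    rw [mem_van] at hG
    by_contra hn
    have := bezout_s1 hF hG.1 hirr hn S h1 hG.2
    omega
  have k := van_finrank S j
  have d1 := hm_finrank j
  by_cases h3 : j < 3
  · have h0 : van S j = ⊥ := by
      rw [eq_bot_iff]
      intro G hG
      rw [Submodule.mem_bot]
      by_contra hG0
      obtain ⟨D, hD⟩ := hd G hG
      have hD0 : D ≠ 0 := by rintro rfl; simp at hD; exact hG0 hD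
      have t1 := (mem_van.mp hG).1.totalDegree hG0
      rw [hD, totalDegree_mul_of_isDomain hirr.ne_zero hD0, hF.totalDegree hirr.ne_zero] at t1
      omega
    rw [h0, finrank_bot] at k
    interval_cases j <;> omega
  · obtain ⟨i, rfl⟩ : ∃ i, j = 3 + i := ⟨j - 3, by omega⟩
    have hle : van S (3 + i) ≤ LinearMap.range (mulL F i) := by
      intro G hG
      obtain ⟨D, hD, h⟩ := hom_quot hF (mem_van.mp hG).1 (hd G hG)
      exact ⟨⟨D, hD⟩, h.symm⟩
    have k1 := Submodule.finrank_mono hle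
    rw [mulL_finrank hirr.ne_zero] at k1
    have d2 := hm_finrank i
    nlinarith

/-- nowhere vanishing relation among the evaluations in degree `d` on `S` -/
def CBd (d : ℕ) (S : Finset (Pt 2)) : Prop :=
  ∃ c : Pt 2 → ℂ, (∀ P ∈ S, c P ≠ 0) ∧
    ∀ F : MvPolynomial (Fin 3) ℂ, F.IsHomogeneous d → ∑ P ∈ S, c P * ev P F = 0

lemma CBd.pairing {i j : ℕ} {S : Finset (Pt 2)} (h : CBd (i + j) S) :
    Module.finrank ℂ (LinearMap.range (evS S i)) + Module.finrank ℂ (LinearMap.range (evS S j))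
      ≤ S.card := by
  obtain ⟨c, hc, hrel⟩ := h
  let θ : (S → ℂ) →ₗ[ℂ] Module.Dual ℂ (S → ℂ) :=
    LinearMap.mk₂ ℂ (fun f g => ∑ P : S, c P * f P * g P)
      (fun f f' g => by
        rw [← Finset.sum_add_distrib]
        exact Finset.sum_congr rfl fun P _ => by rw [Pi.add_apply]; ring)
      (fun a f g => by
        rw [smul_eq_mul, Finset.mul_sum]
        exact Finset.sum_congr rfl fun P _ => by rw [Pi.smul_apply, smul_eq_mul]; ring)
      (fun f g g' => by
        rw [← Finset.sum_add_distrib]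
        exact Finset.sum_congr rfl fun P _ => by rw [Pi.add_apply]; ring)
      (fun a f g => by
        rw [smul_eq_mul, Finset.mul_sum]
        exact Finset.sum_congr rfl fun P _ => by rw [Pi.smul_apply, smul_eq_mul]; ring)
  have hθa : ∀ f g, θ f g = ∑ P : S, c P * f P * g P := fun f g => rfl
  have hθ : Function.Injective θ := by
    rw [injective_iff_map_eq_zero]
    intro f hf
    funext P
    have := LinearMap.congr_fun hf (Pi.single P 1)
    rw [hθa, Finset.sum_eq_single P] at this
    · simpa [hc P.1 P.2] using this
    · intro Q _ hQ
      simp [hQ]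
    · simp
  have hle : (LinearMap.range (evS S i)).map θ ≤ (LinearMap.range (evS S j)).dualAnnihilator := by
    rintro _ ⟨_, ⟨F, rfl⟩, rfl⟩
    rw [Submodule.mem_dualAnnihilator]
    rintro _ ⟨G, rfl⟩
    have := hrel (F.1 * G.1) (F.2.mul G.2)
    rw [← Finset.sum_coe_sort] at this
    rw [← this, hθa]
    refine Finset.sum_congr rfl fun P _ => ?_
    change c P * ev P.1 F.1 * ev P.1 G.1 = _
    rw [map_mul]; ring
  have k1 := Submodule.finrank_mono hle
  rw [(Submodule.equivMapOfInjective θ hθ _).finrank_eq.symm] at k1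
  have k2 := Subspace.finrank_add_finrank_dualAnnihilator_eq (LinearMap.range (evS S j))
  simp only [Module.finrank_fintype_fun_eq_card, Fintype.card_coe] at k2
  omega

lemma CBd.res {d e : ℕ} {S : Finset (Pt 2)} (h : CBd (d + e) S) {F : MvPolynomial (Fin 3) ℂ}
    (hF : F.IsHomogeneous e) : CBd d (S.filter fun P => ¬ ev P F = 0) := by
  obtain ⟨c, hc, hrel⟩ := h
  refine ⟨fun P => c P * ev P F, ?_, ?_⟩
  · intro P hP
    rw [Finset.mem_filter] at hP
    exact mul_ne_zero (hc P hP.1) hP.2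
  · intro G hG
    refine Eq.trans ?_ (hrel (G * F) (hG.mul hF))
    rw [Finset.sum_filter]
    apply Finset.sum_congr rfl
    intro P _
    by_cases h : ev P F = 0
    · simp [h]
    · rw [if_pos h, map_mul]; ring

lemma CBd.card {d : ℕ} {S : Finset (Pt 2)} (h : CBd d S) (hS : S.Nonempty) : d + 2 ≤ S.card := by
  by_contra hlt
  obtain ⟨c, hc, hrel⟩ := h
  obtain ⟨P, hP⟩ := hS
  have := Finset.card_erase_of_mem hP
  obtain ⟨F, hF, h1, h2⟩ := exists_sep_s1 d (S.erase P) P (by simp) (by omega)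
  have h3 := hrel F hF
  rw [Finset.sum_eq_single_of_mem P hP] at h3
  · simp [hc P hP, h1] at h3
  · intro Q hQ hQP
    rw [h2 Q (by simp [hQ, hQP]), mul_zero]

/-- number of points of `S` on the curve `F` -/
def onc (S : Finset (Pt 2)) (F : MvPolynomial (Fin 3) ℂ) : Finset (Pt 2) :=
  S.filter fun P => ev P F = 0

def off (S : Finset (Pt 2)) (F : MvPolynomial (Fin 3) ℂ) : Finset (Pt 2) :=
  S.filter fun P => ¬ ev P F = 0

lemma on_off (S : Finset (Pt 2)) (F : MvPolynomial (Fin 3) ℂ) :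
    (onc S F).card + (off S F).card = S.card :=
  Finset.card_filter_add_card_filter_not _

lemma exists_max (S : Finset (Pt 2)) (e : ℕ) :
    ∃ F : MvPolynomial (Fin 3) ℂ, F.IsHomogeneous e ∧ F ≠ 0 ∧
      (∀ G : MvPolynomial (Fin 3) ℂ, G.IsHomogeneous e → G ≠ 0 → (onc S G).card ≤ (onc S F).card)
      ∧ ∀ k, k ≤ S.card → 2 * k < (e + 1) * (e + 2) → k ≤ (onc S F).card := by
  let I : Set ℕ := {n | ∃ F : MvPolynomial (Fin 3) ℂ, F.IsHomogeneous e ∧ F ≠ 0 ∧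
    (onc S F).card = n}
  have hb : BddAbove I := ⟨S.card, by
    rintro n ⟨F, _, _, rfl⟩
    exact Finset.card_le_card (Finset.filter_subset _ _)⟩
  have hne : I.Nonempty := ⟨_, X 0 ^ e, by simpa using (isHomogeneous_X ℂ (0 : Fin 3)).pow e,
    pow_ne_zero _ (X_ne_zero _), rfl⟩
  obtain ⟨F, hF, hF0, hFc⟩ := Nat.sSup_mem hne hb
  have hmax : ∀ G : MvPolynomial (Fin 3) ℂ, G.IsHomogeneous e → G ≠ 0 →
      (onc S G).card ≤ (onc S F).card := by
    intro G hG hG0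
    rw [hFc]
    exact le_csSup hb ⟨G, hG, hG0, rfl⟩
  refine ⟨F, hF, hF0, hmax, ?_⟩
  intro k hk hke
  obtain ⟨U, hU, hUc⟩ := Finset.exists_subset_card_eq hk
  obtain ⟨G, hG, hG0, hGU⟩ := exists_through U e (by rw [hUc]; exact hke)
  refine le_trans ?_ (hmax G hG hG0)
  rw [← hUc]
  apply Finset.card_le_card
  intro P hP
  exact Finset.mem_filter.mpr ⟨hU hP, hGU P hP⟩



lemma CBd.off {d e : ℕ} {S : Finset (Pt 2)} (h : CBd (d + e) S) {F : MvPolynomial (Fin 3) ℂ}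
    (hF : F.IsHomogeneous e) : CBd d (off S F) := h.res hF

lemma off_subset (S : Finset (Pt 2)) (F : MvPolynomial (Fin 3) ℂ) : off S F ⊆ S :=
  Finset.filter_subset _ _

lemma vanish_of_off_empty {S : Finset (Pt 2)} {F : MvPolynomial (Fin 3) ℂ}
    (h : ¬ (off S F).Nonempty) : ∀ P ∈ S, ev P F = 0 := by
  intro P hP
  by_contra h0
  exact h ⟨P, Finset.mem_filter.mpr ⟨hP, h0⟩⟩

lemma off_sub_on {S : Finset (Pt 2)} {F G : MvPolynomial (Fin 3) ℂ}
    (h : ∀ P ∈ off S F, ev P G = 0) : (off S F).card ≤ (onc S G).card := by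
  apply Finset.card_le_card
  intro P hP
  exact Finset.mem_filter.mpr ⟨(Finset.mem_filter.mp hP).1, h P hP⟩

lemma off_sub_on' {S : Finset (Pt 2)} {F G : MvPolynomial (Fin 3) ℂ}
    (h : ∀ P ∈ off S F, ev P G = 0) : (off S G).card ≤ (onc S F).card := by
  apply Finset.card_le_card
  intro P hP
  obtain ⟨h1, h2⟩ := Finset.mem_filter.mp hP
  refine Finset.mem_filter.mpr ⟨h1, ?_⟩
  by_contra h3
  exact h2 (h P (Finset.mem_filter.mpr ⟨h1, h3⟩))

lemma vanish_mul {S : Finset (Pt 2)} {F G : MvPolynomial (Fin 3) ℂ}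
    (h : ∀ P ∈ off S F, ev P G = 0) : ∀ P ∈ S, ev P (F * G) = 0 := by
  intro P hP
  rw [map_mul]
  by_cases h3 : ev P F = 0
  · simp [h3]
  · rw [h P (Finset.mem_filter.mpr ⟨hP, h3⟩), mul_zero]

lemma onc_eq {S : Finset (Pt 2)} {F : MvPolynomial (Fin 3) ℂ}
    (h : ∀ P ∈ S, ev P F = 0) : (onc S F).card = S.card := by
  rw [onc, Finset.filter_true_of_mem h]

def InCurve (e : ℕ) (S : Finset (Pt 2)) : Prop :=
  ∃ F : MvPolynomial (Fin 3) ℂ, F.IsHomogeneous e ∧ F ≠ 0 ∧ ∀ P ∈ S, ev P F = 0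

lemma line_lemma (d : ℕ) : ∀ S : Finset (Pt 2), CBd d S → S.card ≤ 2 * d + 1 → InCurve 1 S := by
  induction d with
  | zero =>
    intro S h hc
    by_cases hS : S.Nonempty
    · have := h.card hS
      omega
    · rw [Finset.not_nonempty_iff_eq_empty] at hS
      exact ⟨X 0, isHomogeneous_X _ _, X_ne_zero _, by simp [hS]⟩
  | succ d ih =>
    intro S h hc
    obtain ⟨l, hl, hl0, hmax, hk⟩ := exists_max S 1
    by_cases hS : (off S l).Nonempty
    · exfalso
      have h1 := h.off hl
      have h2 := h1.card hS
      have h3 := on_off S l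
      have h4 := hk 2 (by omega) (by norm_num)
      obtain ⟨l', hl', hl0', hv⟩ := ih _ h1 (by omega)
      have h5 := hmax l' hl' hl0'
      have h6 := off_sub_on hv
      omega
    · exact ⟨l, hl, hl0, vanish_of_off_empty hS⟩

lemma conic_of_line {S : Finset (Pt 2)} (h : InCurve 1 S) : InCurve 2 S := by
  obtain ⟨l, hl, hl0, hv⟩ := h
  refine ⟨l * l, hl.mul hl, mul_ne_zero hl0 hl0, fun P hP => by simp [hv P hP]⟩

lemma conic_lemma (d : ℕ) : ∀ S : Finset (Pt 2), CBd d S → S.card + 1 ≤ 3 * d → InCurve 2 S := by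
  induction d using Nat.strong_induction_on with
  | _ d ih =>
  intro S h hc
  by_contra hcon
  have hline : 2 * d + 2 ≤ S.card := by
    by_contra hlt
    exact hcon (conic_of_line (line_lemma d S h (by omega)))
  obtain ⟨l, hl, hl0, lmax, lk⟩ := exists_max S 1
  obtain ⟨q, hq, hq0, qmax, qk⟩ := exists_max S 2
  obtain ⟨f, hf, hf0, fmax, fk⟩ := exists_max S 3
  have hl1 := on_off S l
  have hq1 := on_off S q
  have hf1 := on_off S f
  obtain ⟨k, rfl⟩ : ∃ k, d = k + 3 := ⟨d - 3, by omega⟩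
  have hlne : (off S l).Nonempty := by
    by_contra hne
    exact hcon (conic_of_line ⟨l, hl, hl0, vanish_of_off_empty hne⟩)
  have hqne : (off S q).Nonempty := by
    by_contra hne
    exact hcon ⟨q, hq, hq0, vanish_of_off_empty hne⟩
  by_cases hm : 3 ≤ (onc S l).card
  · have h1 : CBd (k + 2) (off S l) := CBd.off (e := 1) h hl
    obtain ⟨q', hq', hq0', hv⟩ := ih (k + 2) (by omega) _ h1 (by omega)
    have h2 : 2 * (k + 2) + 2 ≤ (off S l).card := by
      by_contra hlt
      obtain ⟨l', hl', hl0', hv'⟩ := line_lemma _ _ h1 (by omega)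
      exact hcon ⟨l * l', hl.mul hl', mul_ne_zero hl0 hl0', vanish_mul hv'⟩
    have h3 : CBd (k + 1) (off S q') := CBd.off (e := 2) h hq'
    by_cases hne : (off S q').Nonempty
    · have := h3.card hne
      have := off_sub_on' hv
      omega
    · exact hcon ⟨q', hq', hq0', vanish_of_off_empty hne⟩
  have hlin : ∀ U : Finset (Pt 2), U ⊆ S → InCurve 1 U → U.card ≤ 2 := by
    rintro U hU ⟨l', hl', hl0', hv⟩
    have h1 := lmax l' hl' hl0'
    have h2 : U.card ≤ (onc S l').card :=
      Finset.card_le_card fun P hP => Finset.mem_filter.mpr ⟨hU hP, hv P hP⟩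
    omega
  have hcon2 : ∀ U : Finset (Pt 2), U ⊆ S → InCurve 2 U → U.card ≤ (onc S q).card := by
    rintro U hU ⟨l', hl', hl0', hv⟩
    have h1 := qmax l' hl' hl0'
    have h2 : U.card ≤ (onc S l').card :=
      Finset.card_le_card fun P hP => Finset.mem_filter.mpr ⟨hU hP, hv P hP⟩
    omega
  by_cases hqc : 6 ≤ (onc S q).card
  · have h1 : CBd (k + 1) (off S q) := CBd.off (e := 2) h hq
    have h2 := hcon2 _ (off_subset _ _) (ih (k + 1) (by omega) _ h1 (by omega))
    have h3 := h1.card hqne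
    by_cases h4 : (off S q).card ≤ 2 * (k + 1) + 1
    · have := hlin _ (off_subset _ _) (line_lemma _ _ h1 h4)
      omega
    · omega
  by_cases hfne : (off S f).Nonempty
  · have h1 : CBd k (off S f) := CBd.off (e := 3) h hf
    have h9 : 9 ≤ (onc S f).card := by
      by_cases h8 : 9 ≤ S.card
      · exact fk 9 h8 (by norm_num)
      · have := fk S.card le_rfl (by omega)
        have := hfne.card_pos
        omega
    have h2 := hcon2 _ (off_subset _ _) (ih k (by omega) _ h1 (by omega))
    have h3 := h1.card hfne
    by_cases h4 : (off S f).card ≤ 2 * k + 1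
    · have := hlin _ (off_subset _ _) (line_lemma _ _ h1 h4)
      omega
    · omega
  have hfv := vanish_of_off_empty hfne
  have hirr : Irreducible f := by
    by_contra hni
    obtain ⟨a, b, ha, hb, hab⟩ := cubic_red hf hf0 hni
    have ha0 : a ≠ 0 := by rintro rfl; simp at hab; exact hf0 hab
    have hb0 : b ≠ 0 := by rintro rfl; simp at hab; exact hf0 hab
    have h1 := lmax a ha ha0
    have h2 := qmax b hb hb0
    have h3 : S ⊆ onc S a ∪ onc S b := by
      intro P hP
      have := hfv P hP
      rw [hab, map_mul, mul_eq_zero] at this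
      rcases this with h | h
      · exact Finset.mem_union_left _ (Finset.mem_filter.mpr ⟨hP, h⟩)
      · exact Finset.mem_union_right _ (Finset.mem_filter.mpr ⟨hP, h⟩)
    have h4 := Finset.card_le_card h3
    have h5 := Finset.card_union_le (onc S a) (onc S b)
    omega
  obtain ⟨i, j, hi, hj, hij⟩ : ∃ i j, 1 ≤ i ∧ i ≤ j ∧ i + j = k + 3 ∧ j ≤ i + 1 :=
    ⟨(k + 3) / 2, k + 3 - (k + 3) / 2, by omega, by omega, by omega, by omega⟩
  have h1 := hf_ge (j := i) hf hirr S hfv (by omega) (by omega)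
  have h2 := hf_ge (j := j) hf hirr S hfv (by omega) (by omega)
  rw [← hij.1] at h
  have h3 := h.pairing
  omega



lemma coeff_linForm_pow (v : Fin 3 → ℂ) (d : ℕ) (s : Fin 3 →₀ ℕ) :
    coeff s ((linForm (m := 2) v) ^ d) =
      if s.degree = d then (s.multinomial : ℂ) * ∏ i, v i ^ s i else 0 := by
  have h := coeff_linearCombination_X_pow_of_fintype v s d
  have h1 : (linForm (m := 2) v) = ∑ i, v i • (X i : MvPolynomial (Fin 3) ℂ) := by
    unfold linForm
    simp only [smul_eq_C_mul]
  rw [h1, h, Finsupp.prod_fintype _ _ (by simp)]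
  rfl

lemma multinomial_ne (s : Fin 3 →₀ ℕ) : (s.multinomial : ℂ) ≠ 0 := by
  rw [Nat.cast_ne_zero]
  exact (Nat.multinomial_pos _ _).ne'

lemma ev_eq_sum (P : Pt 2) (F : MvPolynomial (Fin 3) ℂ) :
    ev P F = ∑ s ∈ F.support, coeff s F * ∏ i, (P.rep i) ^ s i := by
  unfold ev
  rw [eval_eq']

lemma apolar_rel {d : ℕ} {S : Finset (Pt 2)} {c : Pt 2 → ℂ}
    (h : ∑ P ∈ S, c P • powRep d P = 0) (F : MvPolynomial (Fin 3) ℂ) (hF : F.IsHomogeneous d) :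
    ∑ P ∈ S, c P * ev P F = 0 := by
  have hs : ∀ s : Fin 3 →₀ ℕ, s.degree = d → ∑ P ∈ S, c P * ∏ i, (P.rep i) ^ s i = 0 := by
    intro s hsd
    have h1 := congrArg (coeff s) h
    rw [coeff_sum, coeff_zero] at h1
    have h2 : ∀ P ∈ S, coeff s (c P • powRep d P) =
        (s.multinomial : ℂ) * (c P * ∏ i, (P.rep i) ^ s i) := by
      intro P _
      have := coeff_linForm_pow P.rep d s
      rw [if_pos hsd] at this
      rw [coeff_smul, powRep, this, smul_eq_mul]
      ring
    rw [Finset.sum_congr rfl h2, ← Finset.mul_sum] at h1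
    exact (mul_eq_zero.mp h1).resolve_left (multinomial_ne s)
  simp_rw [ev_eq_sum, Finset.mul_sum]
  rw [Finset.sum_comm]
  apply Finset.sum_eq_zero
  intro s hsF
  have hdeg : s.degree = d := by
    by_contra hne
    exact (mem_support_iff.mp hsF) (hF.coeff_eq_zero hne)
  have := hs s hdeg
  calc _ = ∑ P ∈ S, coeff s F * (c P * ∏ i, (P.rep i) ^ s i) :=
        Finset.sum_congr rfl fun P _ => by ring
    _ = 0 := by rw [← Finset.mul_sum, this, mul_zero]

lemma multinomial_sub (s : Fin 3 →₀ ℕ) (j : Fin 3) (hj : s j ≠ 0) :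
    (∏ i, (s i).factorial) * (s - Finsupp.single j 1).multinomial =
      s j * (s.degree - 1).factorial := by
  obtain ⟨t, rfl⟩ : ∃ t, s = t + Finsupp.single j 1 := by
    refine ⟨s - Finsupp.single j 1, ?_⟩
    rw [tsub_add_cancel_of_le]
    rw [Finsupp.single_le_iff]
    omega
  rw [add_tsub_cancel_right, map_add, Finsupp.degree_single, Nat.add_sub_cancel]
  have h1 := Nat.multinomial_spec (Finset.univ : Finset (Fin 3)) t
  rw [Finsupp.multinomial_of_support_subset (Finset.subset_univ _)] at h1
  rw [Finsupp.degree_eq_sum, ← h1]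
  have h2 : (∏ i, ((t + Finsupp.single j 1 : Fin 3 →₀ ℕ) i).factorial) = (t j + 1) * ∏ i, (t i).factorial := by
    fin_cases j <;> simp [Fin.prod_univ_three, Nat.factorial_succ, Finsupp.single_apply] <;> ring
  rw [h2]
  simp
  ring

lemma coeff_terracini (v : Fin 3 → ℂ) (d : ℕ) (s : Fin 3 →₀ ℕ) (hs : s.degree = d + 1) (j : Fin 3) :
    ((∏ i, (s i).factorial : ℕ) : ℂ) * coeff s (X j * (linForm (m := 2) v) ^ d) =
      (d.factorial : ℂ) * eval v (pderiv j (monomial s 1)) := by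
  rw [pderiv_monomial, eval_monomial, Finsupp.prod_fintype _ _ (by simp), coeff_X_mul']
  by_cases hj : s j = 0
  · simp [hj]
  · rw [if_pos (by simpa using hj), coeff_linForm_pow, if_pos]
    · have h := multinomial_sub s j hj
      rw [hs, Nat.add_sub_cancel] at h
      have h' : ((∏ i, (s i).factorial : ℕ) : ℂ) * ((s - Finsupp.single j 1).multinomial : ℂ) =
        (s j : ℂ) * (d.factorial : ℂ) := by exact_mod_cast h
      rw [← mul_assoc, h']
      ring
    · have : s = (s - Finsupp.single j 1) + Finsupp.single j 1 := by
        rw [tsub_add_cancel_of_le]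
        rw [Finsupp.single_le_iff]
        omega
      have h2 := congrArg Finsupp.degree this
      rw [map_add, Finsupp.degree_single] at h2
      omega

/-- the gradient map -/
def grad (A : Finset (Pt 2)) (d : ℕ) : Hm d →ₗ[ℂ] (A × Fin 3 → ℂ) where
  toFun G q := ev q.1.1 (pderiv q.2 G.1)
  map_add' F G := by funext P; simp
  map_smul' c F := by funext P; simp [ev, smul_eq_C_mul]

lemma grad_surj (A : Finset (Pt 2)) (d : ℕ)
    (hT : LinearIndependent ℂ (fun q : (↥A) × Fin 3 =>
        (X q.2 : MvPolynomial (Fin 3) ℂ) * linForm (q.1 : Pt 2).rep ^ d)) :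
    Function.Surjective (grad A (d + 1)) := by
  rw [← LinearMap.range_eq_top]
  by_contra hne
  obtain ⟨f, hf0, hf⟩ := Submodule.exists_le_ker_of_lt_top _ (lt_top_iff_ne_top.mpr hne)
  apply hf0
  rw [Fintype.linearIndependent_iff] at hT
  have hz := hT (fun q => f (Pi.single q 1)) ?_
  · apply LinearMap.ext
    intro y
    rw [LinearMap.pi_apply_eq_sum_univ f y]
    apply Finset.sum_eq_zero
    intro q _
    have h1 := hz q
    have h2 : (fun j => if q = j then (1:ℂ) else 0) = Pi.single q 1 := by
      funext j; simp [Pi.single_apply, eq_comm]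
    rw [h2, h1, smul_zero]
  · ext s
    rw [coeff_sum, coeff_zero]
    by_cases hs : s.degree = d + 1
    · have h1 : f (grad A (d + 1) ⟨monomial s 1, isHomogeneous_monomial _ hs⟩) = 0 := hf ⟨_, rfl⟩
      rw [LinearMap.pi_apply_eq_sum_univ f] at h1
      have hne : ((∏ i, (s i).factorial : ℕ) : ℂ) ≠ 0 := by
        rw [Nat.cast_ne_zero]
        exact Finset.prod_ne_zero_iff.mpr fun i _ => Nat.factorial_ne_zero _
      apply (mul_eq_zero.mp _).resolve_left hne
      rw [Finset.mul_sum]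
      have h3 : ((d.factorial : ℂ)) * 0 = 0 := mul_zero _
      rw [← h1, Finset.mul_sum, h1] at h3
      rw [← h3]
      apply Finset.sum_congr rfl
      intro q _
      have h2 : (fun j => if q = j then (1:ℂ) else 0) = Pi.single q 1 := by
        funext j; simp [Pi.single_apply, eq_comm]
      have h4 := coeff_terracini q.1.1.rep d s hs q.2
      rw [h2, coeff_smul, smul_eq_mul, smul_eq_mul]
      have h5 : grad A (d + 1) ⟨monomial s 1, isHomogeneous_monomial _ hs⟩ q =
        eval (q.1.1.rep : Fin 3 → ℂ) (pderiv q.2 (monomial s 1)) := rfl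
      rw [h5]
      linear_combination f (Pi.single q 1) * h4
    · apply Finset.sum_eq_zero
      intro q _
      rw [coeff_smul, IsHomogeneous.coeff_eq_zero (n := d + 1) _ hs, smul_zero]
      have h1 : (linForm (m := 2) (q.1 : Pt 2).rep).IsHomogeneous 1 := by
        unfold linForm
        exact IsHomogeneous.sum _ _ _ fun i _ => isHomogeneous_C_mul_X _ _
      have := (isHomogeneous_X ℂ q.2).mul (h1.pow d)
      convert this using 1
      omega

lemma perp_exists (a : Fin 3 → ℂ) : ∃ w : Fin 2 → Fin 3 → ℂ,
    (∀ i, ∑ j, w i j * a j = 0) ∧ ∀ y : Fin 2 → ℂ, ∃ g : Fin 3 → ℂ, ∀ i, ∑ j, w i j * g j = y i := by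
  by_cases h2 : a 2 = 0
  · by_cases h1 : a 1 = 0
    · refine ⟨![![0, 1, 0], ![0, 0, 1]], ?_, fun y => ⟨![0, y 0, y 1], ?_⟩⟩
      · intro i; fin_cases i <;> simp [Fin.sum_univ_three, h1, h2]
      · intro i; fin_cases i <;> simp [Fin.sum_univ_three]
    · refine ⟨![![1, - a 0 / a 1, 0], ![0, 0, 1]], ?_, fun y => ⟨![y 0, 0, y 1], ?_⟩⟩
      · intro i; fin_cases i <;> simp [Fin.sum_univ_three, h1, h2]
      · intro i; fin_cases i <;> simp [Fin.sum_univ_three]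
  · refine ⟨![![1, 0, - a 0 / a 2], ![0, 1, - a 1 / a 2]], ?_, fun y => ⟨![y 0, y 1, 0], ?_⟩⟩
    · intro i; fin_cases i <;> simp [Fin.sum_univ_three, h2]
    · intro i; fin_cases i <;> simp [Fin.sum_univ_three]

lemma terracini_count {A U : Finset (Pt 2)} {k e : ℕ} (hU : U ⊆ A)
    (hs : Function.Surjective (grad A (e + k))) (hc : ∃ F : MvPolynomial (Fin 3) ℂ,
      F.IsHomogeneous e ∧ F ≠ 0 ∧ ∀ P ∈ U, ev P F = 0) :
    2 * U.card + Module.finrank ℂ (Hm k) ≤ Module.finrank ℂ (Hm (e + k)) := by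
  obtain ⟨F, hF, hF0, hv⟩ := hc
  choose w hw hg using fun P : Pt 2 => perp_exists (fun j => ev P (pderiv j F))
  let M : Hm (e + k) →ₗ[ℂ] (U × Fin 2 → ℂ) :=
    { toFun := fun G q => ∑ j, w q.1 q.2 j * ev q.1.1 (pderiv j G.1)
      map_add' := fun G G' => by
        funext q; simp [mul_add, Finset.sum_add_distrib]
      map_smul' := fun c G => by
        funext q
        simp only [Pi.smul_apply, smul_eq_mul, Finset.mul_sum, RingHom.id_apply]
        refine Finset.sum_congr rfl fun j _ => ?_
        simp [ev, smul_eq_C_mul]; ring }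
  have hM : ∀ G q, M G q = ∑ j, w q.1 q.2 j * ev q.1.1 (pderiv j G.1) := fun _ _ => rfl
  have hsurj : Function.Surjective M := by
    intro y
    choose g hgy using fun P : U => hg P.1 (fun i => y (P, i))
    obtain ⟨G, hG⟩ := hs (fun q => if h : q.1.1 ∈ U then g ⟨q.1.1, h⟩ q.2 else 0)
    refine ⟨G, funext fun q => ?_⟩
    rw [hM, ← hgy q.1 q.2]
    refine Finset.sum_congr rfl fun j _ => ?_
    have h1 := congrFun hG (⟨q.1.1, hU q.1.2⟩, j)
    rw [dif_pos q.1.2] at h1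
    change ev q.1.1 (pderiv j G.1) = g q.1 j at h1
    rw [h1]
  have hle : LinearMap.range (mulL F k) ≤ (LinearMap.ker M).map (Hm (e + k)).subtype := by
    rintro _ ⟨G, rfl⟩
    refine ⟨⟨F * G.1, hF.mul G.2⟩, ?_, rfl⟩
    rw [SetLike.mem_coe, LinearMap.mem_ker]
    funext q
    rw [hM, Pi.zero_apply]
    have h1 := hw q.1 q.2
    have h2 := hv q.1.1 q.1.2
    calc _ = ∑ j, ev q.1.1 G.1 * (w q.1 q.2 j * ev q.1.1 (pderiv j F)) := by
          refine Finset.sum_congr rfl fun j _ => ?_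
          rw [pderiv_mul, map_add, map_mul, map_mul, h2]
          ring
      _ = 0 := by rw [← Finset.mul_sum, h1, mul_zero]
  have k1 := Submodule.finrank_mono hle
  rw [mulL_finrank hF0, Submodule.finrank_map_subtype_eq] at k1
  have k2 := LinearMap.finrank_range_add_finrank_ker M
  rw [LinearMap.range_eq_top.mpr hsurj] at k2
  simp at k2
  omega

lemma main_aux (n : ℕ) (T : MvPolynomial (Fin 3) ℂ)
    (A : Finset (Pt 2)) (hA : IsDecomp (2 * n + 8) A T)
    (hAnr : NonRedundant (2 * n + 8) A T)
    (hr : A.card ≤ 3 * n + 11)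
    (hTerracini : LinearIndependent ℂ
      (fun q : (↥A) × Fin 3 =>
        (X q.2 : MvPolynomial (Fin 3) ℂ) * linForm (q.1 : Pt 2).rep ^ (2 * n + 8 - 1)))
    (B : Finset (Pt 2)) (hB : IsDecomp (2 * n + 8) B T) (hBA : B.card ≤ A.card) : B = A := by
  obtain ⟨a, ha⟩ := hA
  obtain ⟨b, hb⟩ := hB
  have ha0 : ∀ P ∈ A, a P ≠ 0 := by
    intro P hP h0
    apply hAnr (A.erase P) (Finset.erase_ssubset hP)
    rw [ha, ← Finset.add_sum_erase A _ hP, h0, zero_smul, zero_add]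
    refine Submodule.sum_mem _ fun Q hQ => Submodule.smul_mem _ _ (Submodule.subset_span ⟨Q, hQ, rfl⟩)
  let c : Pt 2 → ℂ := fun P => (if P ∈ A then a P else 0) - (if P ∈ B then b P else 0)
  let S := (A ∪ B).filter fun P => c P ≠ 0
  have hrel : ∑ P ∈ S, c P • powRep (2 * n + 8) P = 0 := by
    have h1 : ∑ P ∈ S, c P • powRep (2 * n + 8) P = ∑ P ∈ A ∪ B, c P • powRep (2 * n + 8) P := by
      apply Finset.sum_subset (Finset.filter_subset _ _)
      intro P hP hPS
      have : c P = 0 := by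
        by_contra h
        exact hPS (Finset.mem_filter.mpr ⟨hP, h⟩)
      rw [this, zero_smul]
    rw [h1]
    simp only [c, sub_smul, ite_smul, zero_smul, Finset.sum_sub_distrib, Finset.sum_ite_mem,
      Finset.union_inter_cancel_left, Finset.union_inter_cancel_right]
    rw [← ha, ← hb, sub_self]
  have hCB : CBd (2 * n + 8) S :=
    ⟨c, fun P hP => (Finset.mem_filter.mp hP).2, fun F hF => apolar_rel hrel F hF⟩
  have hAB : A \ B ⊆ S ∩ A := by
    intro P hP
    obtain ⟨h1, h2⟩ := Finset.mem_sdiff.mp hP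
    refine Finset.mem_inter.mpr ⟨Finset.mem_filter.mpr ⟨Finset.mem_union_left _ h1, ?_⟩, h1⟩
    simp only [c, if_pos h1, if_neg h2, sub_zero]
    exact ha0 P h1
  have hSA : S \ A ⊆ B \ A := by
    intro P hP
    obtain ⟨h1, h2⟩ := Finset.mem_sdiff.mp hP
    have := (Finset.mem_filter.mp h1).1
    grind
  have c1 := Finset.card_le_card hAB
  have c2 := Finset.card_le_card hSA
  have c3 := Finset.card_sdiff_add_card_inter A B
  have c4 := Finset.card_sdiff_add_card_inter B A
  have c5 := Finset.card_sdiff_add_card_inter S A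
  have c6 := Finset.card_le_card (Finset.inter_subset_right : S ∩ A ⊆ A)
  rw [Finset.inter_comm] at c4
  have hU : S ∩ A ⊆ A := Finset.inter_subset_right
  have hsurj := grad_surj A (2 * n + 7) hTerracini
  have hsub : ∀ e, InCurve e S → ∃ F : MvPolynomial (Fin 3) ℂ,
      F.IsHomogeneous e ∧ F ≠ 0 ∧ ∀ P ∈ S ∩ A, ev P F = 0 := by
    rintro e ⟨F, h1, h2, h3⟩
    exact ⟨F, h1, h2, fun P hP => h3 P (Finset.mem_inter.mp hP).1⟩
  have hsurj2 : Function.Surjective (grad A (2 + (2 * n + 6))) := by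
    have e : 2 + (2 * n + 6) = 2 * n + 7 + 1 := by omega
    rw [e]; exact hsurj
  have hsurj1 : Function.Surjective (grad A (1 + (2 * n + 7))) := by
    have e : 1 + (2 * n + 7) = 2 * n + 7 + 1 := by omega
    rw [e]; exact hsurj
  have t2 := terracini_count hU hsurj2 (hsub 2 (conic_lemma _ S hCB (by omega)))
  have d1 := hm_finrank (2 * n + 6)
  have d2 := hm_finrank (2 + (2 * n + 6))
  have u2 : (S ∩ A).card ≤ 2 * n + 8 := by
    have : 4 * (S ∩ A).card ≤ 2 * (2 * (2 * n + 8) + 1) := by nlinarith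
    omega
  have t1 := terracini_count hU hsurj1 (hsub 1 (line_lemma _ S hCB (by omega)))
  have d3 := hm_finrank (2 * n + 7)
  have d4 := hm_finrank (1 + (2 * n + 7))
  have u1 : (S ∩ A).card ≤ n + 4 := by
    have : 4 * (S ∩ A).card ≤ 2 * (2 * n + 9) := by nlinarith
    omega
  have hSe : ¬ S.Nonempty := fun h => by
    have := hCB.card h
    omega
  rw [Finset.not_nonempty_iff_eq_empty] at hSe
  have hAsub : A ⊆ B := by
    rw [← Finset.sdiff_eq_empty_iff_subset, ← Finset.subset_empty]
    refine hAB.trans ?_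
    rw [hSe]; simp
  exact (Finset.eq_of_subset_of_card_le hAsub hBA).symm


/-- Terracini's test. If the `3r` forms `x_j · L_i^{d-1}` are linearly
independent (i.e. the Terracini space has dimension `3r`), then the decomposition `A`
is minimal and `T` is identifiable: `A` is the unique decomposition of `T` of length
at most `r`. Here `d = 2n+8` and `r = ℓ(A) ≤ 3n+11`. -/
theorem stmt1 (n : ℕ) (T : MvPolynomial (Fin 3) ℂ) (hT0 : T ≠ 0)
    (hThom : T.IsHomogeneous (2 * n + 8))
    (A : Finset (Pt 2)) (hA : IsDecomp (2 * n + 8) A T)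
    (hAnr : NonRedundant (2 * n + 8) A T)
    (hr : A.card ≤ 3 * n + 11)
    (hTerracini : LinearIndependent ℂ
      (fun q : (↥A) × Fin 3 =>
        (X q.2 : MvPolynomial (Fin 3) ℂ) * linForm (q.1 : Pt 2).rep ^ (2 * n + 8 - 1))) :
    (∀ B : Finset (Pt 2), IsDecomp (2 * n + 8) B T → A.card ≤ B.card) ∧
      (∀ B : Finset (Pt 2), IsDecomp (2 * n + 8) B T → B.card ≤ A.card → B = A) := by
  refine ⟨fun B hB => ?_, fun B hB hBA => main_aux n T A hA hAnr hr hTerracini B hB hBA⟩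
  by_contra hlt
  have := main_aux n T A hA hAnr hr hTerracini B hB (by omega)
  rw [this] at hlt
  omega

end
end
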